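/- Each object T_i is isomorphic in D(Mod Λ) to a bounded complex of finitely generated injective Λ-modules. -/

import Mathlib

open CategoryTheory Limits Pretriangulated ZeroObject

noncomputable section

namespace RickardKoenigYang

universe w v u

variable (K : Type) [Field K] [IsAlgClosed K]
variable (Λ : Type) [Ring Λ] [Algebra K Λ] [FiniteDimensional K Λ]

/-- `Λ` is a basic algebra (over the algebraically closed field `K`): every simple
`Λ`-module is one-dimensional over `K`. -/
def IsBasicAlgebra : Prop :=
  ∀ (M : Type) [AddCommGroup M] [Module K M] [Module Λ M] [IsScalarTower K Λ M],
    IsSimpleModule Λ M → Module.finrank K M = 1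

/-- A complete family of `r` pairwise non-isomorphic simple `Λ`-modules; this expresses
that `r` is the rank of the Grothendieck group of `mod Λ`. -/
def IsCompleteFamilyOfSimples (r : ℕ) : Prop :=
  ∃ S : Fin r → ModuleCat.{0} Λ,
    (∀ i, IsSimpleModule Λ (S i)) ∧
    (∀ i j, i ≠ j → IsEmpty (S i ≅ S j)) ∧
    (∀ M : ModuleCat.{0} Λ, IsSimpleModule Λ M → ∃ i, Nonempty (M ≅ S i))

section Thick

variable {C : Type u} [Category.{v} C] [Preadditive C] [HasZeroObject C] [HasShift C ℤ]
  [∀ n : ℤ, (shiftFunctor C n).Additive] [Pretriangulated C]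

/-- Membership in the thick (= épaisse) triangulated subcategory generated by a set `S`
of objects: the closure of `S` under isomorphisms, shifts, extensions
(cones of morphisms) and direct summands. -/
inductive ThickMem (S : Set C) : C → Prop
  | of (X : C) (hX : X ∈ S) : ThickMem S X
  | zero : ThickMem S 0
  | iso {X Y : C} (e : X ≅ Y) (hX : ThickMem S X) : ThickMem S Y
  | shift (X : C) (n : ℤ) (hX : ThickMem S X) : ThickMem S (X⟦n⟧)
  | ext (T : Triangle C) (hT : T ∈ distTriang C) (h₁ : ThickMem S T.obj₁)
      (h₃ : ThickMem S T.obj₃) : ThickMem S T.obj₂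
  | summand {X Y : C} (i : X ⟶ Y) (p : Y ⟶ X) (hip : i ≫ p = 𝟙 X) (hY : ThickMem S Y) :
      ThickMem S X

end Thick

variable [HasDerivedCategory (ModuleCat.{0} Λ)]

/-- An object of `D(Mod Λ)` belongs to `D^b(mod Λ)`: it is isomorphic to a bounded
complex of finitely generated `Λ`-modules. -/
def IsDbObject (C : DerivedCategory (ModuleCat.{0} Λ)) : Prop :=
  ∃ M : CochainComplex (ModuleCat.{0} Λ) ℤ,
    (∃ a b : ℤ, ∀ n : ℤ, (n < a ∨ b < n) → IsZero (M.X n)) ∧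
    (∀ n : ℤ, Module.Finite Λ (M.X n)) ∧
    Nonempty (DerivedCategory.Q.obj M ≅ C)

variable [CategoryTheory.Linear K (DerivedCategory (ModuleCat.{0} Λ))]
  [(DerivedCategory.Qh (C := ModuleCat.{0} Λ)).Linear K]

/-- A simple-minded collection `X_1, …, X_r` in `D^b(mod Λ) ⊆ D(Mod Λ)`. -/
structure IsSimpleMindedCollection (r : ℕ) (X : Fin r → DerivedCategory (ModuleCat.{0} Λ)) :
    Prop where
  mem_Db : ∀ i, IsDbObject Λ (X i)
  hom_neg_shift_vanish : ∀ i j (m : ℤ), m < 0 → ∀ f : X i ⟶ (X j)⟦m⟧, f = 0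
  end_dim : ∀ i, Module.finrank K (X i ⟶ X i) = 1
  hom_ne_vanish : ∀ i j, i ≠ j → ∀ f : X i ⟶ X j, f = 0
  generates : ∀ C : DerivedCategory (ModuleCat.{0} Λ), IsDbObject Λ C ↔ ThickMem (Set.range X) C

variable {Λ}

/-- The data of Rickard's construction of the objects `T_1, …, T_r` from a collection
`X_1, …, X_r`: the sequences `X_i = X_i⁽⁰⁾ → X_i⁽¹⁾ → ⋯`, where `X_i⁽ⁿ⁺¹⁾` is a cone of
the canonical map `Z_i⁽ⁿ⁾ = ⊕_{m<0} ⊕_j ⊕_{B(j,m,i,n)} Σ^m X_j → X_i⁽ⁿ⁾` whose component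
corresponding to a basis vector `f ∈ B(j,m,i,n)` of `Hom(Σ^m X_j, X_i⁽ⁿ⁾)` is `f` itself,
and `T_i` is the Milnor colimit of the sequence. -/
structure RickardData (r : ℕ) (X : Fin r → DerivedCategory (ModuleCat.{0} Λ)) where
  /-- the objects `X_i⁽ⁿ⁾` -/
  Xs : Fin r → ℕ → DerivedCategory (ModuleCat.{0} Λ)
  Xs_zero : ∀ i, Xs i 0 = X i
  /-- `B j m i n` is a chosen basis of `Hom(Σ^m X_j, X_i⁽ⁿ⁾)` (for `m < 0`) -/
  B : ∀ (j : Fin r) (m : ℤ) (i : Fin r) (n : ℕ), Set ((X j)⟦m⟧ ⟶ Xs i n)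
  B_indep : ∀ j m i n, m < 0 →
    LinearIndependent K (fun f : B j m i n => (f : (X j)⟦m⟧ ⟶ Xs i n))
  B_span : ∀ j m i n, m < 0 → Submodule.span K (B j m i n) = ⊤
  /-- the objects `Z_i⁽ⁿ⁾` -/
  Z : Fin r → ℕ → DerivedCategory (ModuleCat.{0} Λ)
  /-- the coproduct inclusions into `Z_i⁽ⁿ⁾` -/
  inc : ∀ (i : Fin r) (n : ℕ)
      (p : Σ (j : Fin r) (m : ℤ), {f : (X j)⟦m⟧ ⟶ Xs i n // m < 0 ∧ f ∈ B j m i n}),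
      (X p.1)⟦p.2.1⟧ ⟶ Z i n
  isColimitZ : ∀ i n, Nonempty (IsColimit (Cofan.mk (Z i n) (inc i n)))
  /-- the canonical morphism `α_i⁽ⁿ⁾ : Z_i⁽ⁿ⁾ → X_i⁽ⁿ⁾` -/
  α : ∀ i n, Z i n ⟶ Xs i n
  inc_α : ∀ i n p, inc i n p ≫ α i n = p.2.2.1
  /-- the morphisms `β_i⁽ⁿ⁾ : X_i⁽ⁿ⁾ → X_i⁽ⁿ⁺¹⁾` -/
  β : ∀ i n, Xs i n ⟶ Xs i (n + 1)
  γ : ∀ i n, Xs i (n + 1) ⟶ (Z i n)⟦(1 : ℤ)⟧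
  dist : ∀ i n, Triangle.mk (α i n) (β i n) (γ i n) ∈ distTriang (DerivedCategory (ModuleCat.{0} Λ))
  /-- the objects `T_i` -/
  T : Fin r → DerivedCategory (ModuleCat.{0} Λ)
  /-- the coproducts `⊕_{n ≥ 0} X_i⁽ⁿ⁾` -/
  CP : Fin r → DerivedCategory (ModuleCat.{0} Λ)
  cinc : ∀ (i : Fin r) (n : ℕ), Xs i n ⟶ CP i
  isColimitCP : ∀ i, Nonempty (IsColimit (Cofan.mk (CP i) (cinc i)))
  /-- the morphism `id - β : ⊕ X_i⁽ⁿ⁾ → ⊕ X_i⁽ⁿ⁾` -/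
  oneSubβ : ∀ i, CP i ⟶ CP i
  cinc_oneSubβ : ∀ i n, cinc i n ≫ oneSubβ i = cinc i n - β i n ≫ cinc i (n + 1)
  toT : ∀ i, CP i ⟶ T i
  δT : ∀ i, T i ⟶ (CP i)⟦(1 : ℤ)⟧
  distT : ∀ i, Triangle.mk (oneSubβ i) (toT i) (δT i) ∈
    distTriang (DerivedCategory (ModuleCat.{0} Λ))

end RickardKoenigYang

namespace RickardKoenigYang

open DerivedCategory

universe w u v t

section Abelian

variable {C : Type u} [Category.{v} C] [Abelian C] [HasDerivedCategory.{w} C]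

lemma exists_Q_map_eq_of_isKProjective (K L : CochainComplex C ℤ) [K.IsKProjective]
    (f : Q.obj K ⟶ Q.obj L) : ∃ φ : K ⟶ L, Q.map φ = f := by
  obtain ⟨g, hg⟩ := (CochainComplex.IsKProjective.Qh_map_bijective K
    ((HomotopyCategory.quotient _ _).obj L)).surjective
    ((quotientCompQhIso C).hom.app K ≫ f ≫ (quotientCompQhIso C).inv.app L)
  obtain ⟨φ, rfl⟩ := (HomotopyCategory.quotient _ _).map_surjective g
  refine ⟨φ, ?_⟩
  rw [← cancel_epi ((quotientCompQhIso C).hom.app K), ← quotientCompQhIso_hom_naturality, hg]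
  simp

lemma exists_Q_map_eq_of_isKInjective (K L : CochainComplex C ℤ) [L.IsKInjective]
    (f : Q.obj K ⟶ Q.obj L) : ∃ φ : K ⟶ L, Q.map φ = f := by
  obtain ⟨g, hg⟩ := (CochainComplex.IsKInjective.Qh_map_bijective
    ((HomotopyCategory.quotient _ _).obj K) L).surjective
    ((quotientCompQhIso C).hom.app K ≫ f ≫ (quotientCompQhIso C).inv.app L)
  obtain ⟨φ, rfl⟩ := (HomotopyCategory.quotient _ _).map_surjective g
  refine ⟨φ, ?_⟩
  rw [← cancel_epi ((quotientCompQhIso C).hom.app K), ← quotientCompQhIso_hom_naturality, hg]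
  simp

instance isKProjective_single (P : C) [Projective P] (n : ℤ) :
    CochainComplex.IsKProjective ((HomologicalComplex.single C (ComplexShape.up ℤ) n).obj P) := by
  have : ∀ i, Projective (((HomologicalComplex.single C (ComplexShape.up ℤ) n).obj P).X i) := by
    intro i
    by_cases hi : i = n
    · exact Projective.of_iso (HomologicalComplex.singleObjXIsoOfEq _ n P i hi).symm inferInstance
    · exact Projective.of_iso
        (HomologicalComplex.isZero_single_obj_X (.up ℤ) n P i hi).isoZero.symm inferInstance
  exact CochainComplex.isKProjective_of_projective _ n

/-- The homology of the image of a complex `K` in the derived category is that of `K`. -/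
def homologyQIso (K : CochainComplex C ℤ) (n : ℤ) :
    K.homology n ≅ (homologyFunctor C n).obj (Q.obj K) :=
  (homologyFunctorFactors C n).symm.app K

lemma homologyQIso_hom_naturality {K L : CochainComplex C ℤ} (φ : K ⟶ L) (n : ℤ) :
    (homologyQIso K n).hom ≫ (homologyFunctor C n).map (Q.map φ) =
      HomologicalComplex.homologyMap φ n ≫ (homologyQIso L n).hom :=
  ((homologyFunctorFactors C n).inv.naturality φ).symm

/-- The `n`th homology of an object placed in degree `n` is this object. -/
def singleHomologyIso (n : ℤ) (P : C) :
    P ≅ (homologyFunctor C n).obj ((singleFunctor C n).obj P) :=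
  (HomologicalComplex.singleObjHomologySelfIso (.up ℤ) n P).symm ≪≫
    homologyQIso ((HomologicalComplex.single C (.up ℤ) n).obj P) n

lemma singleHomologyIso_hom_naturality (n : ℤ) {P P' : C} (a : P' ⟶ P) :
    (singleHomologyIso n P').hom ≫
      (homologyFunctor C n).map ((singleFunctor C n).map a) =
    a ≫ (singleHomologyIso n P).hom := by
  have h₁ := homologyQIso_hom_naturality ((HomologicalComplex.single C (.up ℤ) n).map a) n
  have h₂ : (HomologicalComplex.singleObjHomologySelfIso (.up ℤ) n P').inv ≫
      HomologicalComplex.homologyMap ((HomologicalComplex.single C (.up ℤ) n).map a) n =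
      a ≫ (HomologicalComplex.singleObjHomologySelfIso (.up ℤ) n P).inv :=
    HomologicalComplex.singleObjHomologySelfIso_inv_naturality (.up ℤ) n a
  exact (Category.assoc _ _ _).trans ((congrArg _ h₁).trans
    ((Category.assoc _ _ _).symm.trans ((congrArg (· ≫ _) h₂).trans (Category.assoc _ _ _))))

/-- The morphism `P ⟶ Hⁿ(X)` induced by a morphism from `P`, placed in degree `n`, to `X`. -/
def singleEval {n : ℤ} {P : C} {X : DerivedCategory C} (f : (singleFunctor C n).obj P ⟶ X) :
    P ⟶ (homologyFunctor C n).obj X :=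
  (singleHomologyIso n P).hom ≫ (homologyFunctor C n).map f

lemma singleEval_comp {n : ℤ} {P : C} {X Y : DerivedCategory C}
    (f : (singleFunctor C n).obj P ⟶ X) (g : X ⟶ Y) :
    singleEval (f ≫ g) = singleEval f ≫ (homologyFunctor C n).map g := by
  simp [singleEval]

lemma singleEval_map_comp {n : ℤ} {P P' : C} {X : DerivedCategory C} (a : P' ⟶ P)
    (f : (singleFunctor C n).obj P ⟶ X) :
    singleEval ((singleFunctor C n).map a ≫ f) = a ≫ singleEval f := by
  rw [singleEval, singleEval, Functor.map_comp, ← Category.assoc,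
    singleHomologyIso_hom_naturality, Category.assoc]

lemma singleEval_zero {n : ℤ} {P : C} {X : DerivedCategory C} :
    singleEval (0 : (singleFunctor C n).obj P ⟶ X) = 0 := by
  simp [singleEval]

lemma singleEval_surjective {n : ℤ} {P : C} [Projective P] {X : DerivedCategory C}
    (x : P ⟶ (homologyFunctor C n).obj X) :
    ∃ f : (singleFunctor C n).obj P ⟶ X, singleEval f = x := by
  obtain ⟨L, ⟨e⟩⟩ : ∃ L, Nonempty (Q.obj L ≅ X) := ⟨_, ⟨Q.objObjPreimageIso X⟩⟩
  let y : P ⟶ L.homology n :=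
    x ≫ (homologyFunctor C n).map e.inv ≫ (homologyQIso L n).inv
  let z : P ⟶ L.cycles n := Projective.factorThru y (L.homologyπ n)
  have hz : z ≫ L.homologyπ n = y := Projective.factorThru_comp _ _
  let φ : (HomologicalComplex.single C (.up ℤ) n).obj P ⟶ L :=
    HomologicalComplex.mkHomFromSingle (z ≫ L.iCycles n) (by simp)
  have hφ : (HomologicalComplex.singleObjHomologySelfIso (.up ℤ) n P).inv ≫
      HomologicalComplex.homologyMap φ n = y := by
    have h : (HomologicalComplex.singleObjCyclesSelfIso (.up ℤ) n P).inv ≫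
      HomologicalComplex.cyclesMap φ n = z := by
      rw [← cancel_mono (L.iCycles n)]
      simp [φ]
    rw [← hz, ← h, HomologicalComplex.singleObjHomologySelfIso, Iso.trans_inv, Iso.symm_inv,
      Category.assoc, Category.assoc, ← HomologicalComplex.homologyπ_naturality]
    rfl
  refine ⟨(show (singleFunctor C n).obj P ⟶ Q.obj L from Q.map φ) ≫ e.hom, ?_⟩
  have key : singleEval (show (singleFunctor C n).obj P ⟶ Q.obj L from Q.map φ) =
      y ≫ (homologyQIso L n).hom :=
    (Category.assoc _ _ _).trans ((congrArg _ (homologyQIso_hom_naturality φ n)).trans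
      ((Category.assoc _ _ _).symm.trans (congrArg (· ≫ _) hφ)))
  rw [singleEval_comp, key]
  simp [y, ← Functor.map_comp]

end Abelian

section Coproducts

variable {D : Type u} [Category.{v} D]

/-- The morphisms `inc p : Y p ⟶ S` exhibit `S` as a coproduct of the family `Y`. -/
structure IsCoprod {ι : Type t} {Y : ι → D} {S : D} (inc : ∀ p, Y p ⟶ S) : Prop where
  exists_desc : ∀ {W : D} (g : ∀ p, Y p ⟶ W), ∃ h : S ⟶ W, ∀ p, inc p ≫ h = g p
  hom_ext : ∀ {W : D} {f g : S ⟶ W}, (∀ p, inc p ≫ f = inc p ≫ g) → f = g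

lemma IsCoprod.of_isColimit {ι : Type t} {Y : ι → D} {S : D} {inc : ∀ p, Y p ⟶ S}
    (h : IsColimit (Cofan.mk S inc)) : IsCoprod inc where
  exists_desc g := ⟨Cofan.IsColimit.desc h g, fun p => Cofan.IsColimit.fac h g p⟩
  hom_ext H := Cofan.IsColimit.hom_ext h _ _ H

lemma IsCoprod.reindex {ι : Type t} {ι' : Type w} {Y : ι → D} {S : D} {inc : ∀ p, Y p ⟶ S}
    (h : IsCoprod inc) (e : ι' ≃ ι) : IsCoprod (fun p => inc (e p)) where
  exists_desc {W} g := by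
    obtain ⟨k, hk⟩ := h.exists_desc (fun p => eqToHom (by simp) ≫ g (e.symm p) : ∀ p, Y p ⟶ W)
    refine ⟨k, fun p => ?_⟩
    rw [hk]
    have : ∀ q (hq : q = p), eqToHom (by rw [hq]) ≫ g q = g p := by
      rintro _ rfl
      simp
    exact this _ (by simp)
  hom_ext H := h.hom_ext fun p => by
    obtain ⟨p, rfl⟩ := e.surjective p
    exact H p

variable [Preadditive D]

open Classical in
lemma IsCoprod.exists_proj {ι : Type t} {Y : ι → D} {S : D} {inc : ∀ p, Y p ⟶ S}
    (h : IsCoprod inc) : ∃ π : ∀ p, S ⟶ Y p, (∀ p, inc p ≫ π p = 𝟙 _) ∧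
      ∀ p q, p ≠ q → inc q ≫ π p = 0 := by
  have : ∀ p, ∃ π : S ⟶ Y p, inc p ≫ π = 𝟙 _ ∧ ∀ q, p ≠ q → inc q ≫ π = 0 := by
    intro p
    obtain ⟨π, hπ⟩ := h.exists_desc
      (fun q => if hq : q = p then eqToHom (by rw [hq]) else 0 : ∀ q, Y q ⟶ Y p)
    exact ⟨π, by simp [hπ], fun q hq => by simp [hπ, hq.symm]⟩
  choose π h₁ h₂ using this
  exact ⟨π, h₁, h₂⟩

/-- Every morphism from `C` to the coproduct `S` factors through a finite subcoproduct. -/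
def FiniteFactor {ι : Type t} {Y : ι → D} {S : D} (inc : ∀ p, Y p ⟶ S) (C : D) : Prop :=
  ∀ f : C ⟶ S, ∃ (F : Finset ι) (g : ∀ p, C ⟶ Y p), f = ∑ p ∈ F, g p ≫ inc p

lemma FiniteFactor.of_reindex {ι : Type t} {ι' : Type w} {Y : ι → D} {S : D}
    {inc : ∀ p, Y p ⟶ S} (e : ι' ≃ ι) {C : D}
    (h : FiniteFactor (fun p => inc (e p)) C) : FiniteFactor inc C := by
  intro f
  obtain ⟨F, g, rfl⟩ := h f
  refine ⟨F.map e.toEmbedding, fun p => g (e.symm p) ≫ eqToHom (by simp), ?_⟩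
  rw [Finset.sum_map]
  refine Finset.sum_congr rfl fun p _ => ?_
  have : ∀ q (hq : q = p), g p ≫ inc (e p) =
      (g q ≫ eqToHom (by rw [hq])) ≫ inc (e p) := by
    rintro _ rfl
    simp
  exact this _ (by simp)

lemma FiniteFactor.of_iso {ι : Type t} {Y : ι → D} {S : D}
    {inc : ∀ p, Y p ⟶ S} {C C' : D} (e : C ≅ C')
    (h : FiniteFactor inc C) : FiniteFactor inc C' := by
  intro f
  obtain ⟨F, g, hf⟩ := h (e.hom ≫ f)
  refine ⟨F, fun p => e.inv ≫ g p, ?_⟩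
  rw [← cancel_epi e.hom, hf, Preadditive.comp_sum]
  simp

end Coproducts

section Modules

variable {Λ : Type} [Ring Λ]

lemma sum_f_eq {V : Type*} [Category V] [Preadditive V] {κ : Type*} {c : ComplexShape κ}
    {K L : HomologicalComplex V c} {ι : Type*} (s : Finset ι) (f : ι → (K ⟶ L)) (n : κ) :
    (∑ p ∈ s, f p).f n = ∑ p ∈ s, (f p).f n :=
  map_sum (HomologicalComplex.Hom.fAddMonoidHom n) f s

open Classical in
lemma coproduct_element_eq_sum {ι : Type} (Y : ι → CochainComplex (ModuleCat.{0} Λ) ℤ) (n : ℤ)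
    (x : (∐ Y).X n) : ∃ F : Finset ι, ∀ F', F ⊆ F' →
      x = ∑ p ∈ F', (Sigma.ι Y p).f n ((Sigma.π Y p).f n x) := by
  classical
  let N : Submodule Λ ((∐ Y).X n) :=
    { carrier := { x | ∃ F : Finset ι, ∀ F', F ⊆ F' →
        x = ∑ p ∈ F', (Sigma.ι Y p).f n ((Sigma.π Y p).f n x) }
      zero_mem' := ⟨∅, fun F' _ => by simp⟩
      add_mem' := by
        rintro x y ⟨F, hF⟩ ⟨G, hG⟩
        refine ⟨F ∪ G, fun F' h => ?_⟩
        simp only [map_add, Finset.sum_add_distrib]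
        rw [← hF F' (Finset.union_subset_left h), ← hG F' (Finset.union_subset_right h)]
      smul_mem' := by
        rintro c x ⟨F, hF⟩
        refine ⟨F, fun F' h => ?_⟩
        simp only [map_smul, ← Finset.smul_sum]
        rw [← hF F' h] }
  suffices N = ⊤ by
    have hx : x ∈ N := by rw [this]; trivial
    exact hx
  have hc := isColimitCofanMkObjOfIsColimit (HomologicalComplex.eval (ModuleCat.{0} Λ)
    (.up ℤ) n) _ (Sigma.ι Y) (coproductIsCoproduct Y)
  have : ModuleCat.ofHom N.mkQ = 0 := by
    refine Cofan.IsColimit.hom_ext hc _ _ fun p => ?_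
    refine ModuleCat.hom_ext (LinearMap.ext fun (y : (Y p).X n) => ?_)
    have hmem : (Sigma.ι Y p).f n y ∈ N := by
      refine ⟨{p}, fun F' h => ?_⟩
      have hp : p ∈ F' := h (Finset.mem_singleton_self p)
      rw [Finset.sum_eq_single_of_mem p hp]
      · have h₁ : (Sigma.ι Y p ≫ Sigma.π Y p).f n y = y := by
          rw [Sigma.ι_π_eq_id]; rfl
        rw [HomologicalComplex.comp_f, ModuleCat.comp_apply] at h₁
        rw [h₁]
      · intro q _ hq
        have h₁ : (Sigma.ι Y p ≫ Sigma.π Y q).f n y = 0 := by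
          rw [Sigma.ι_π_of_ne _ hq.symm]; rfl
        rw [HomologicalComplex.comp_f, ModuleCat.comp_apply] at h₁
        rw [h₁, map_zero]
    exact (Submodule.Quotient.mk_eq_zero N).2 hmem
  have h := congrArg ModuleCat.Hom.hom this
  have h' : N.mkQ = 0 := h
  rw [← Submodule.ker_mkQ N, h', LinearMap.ker_zero]

open Classical in
lemma hom_coproduct_eq_sum {ι : Type} (Y : ι → CochainComplex (ModuleCat.{0} Λ) ℤ) (n : ℤ)
    (P : ModuleCat.{0} Λ) [Module.Finite Λ P]
    (f : (HomologicalComplex.single _ (.up ℤ) n).obj P ⟶ ∐ Y) : ∃ F : Finset ι,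
      f = ∑ p ∈ F, (f ≫ Sigma.π Y p) ≫ Sigma.ι Y p := by
  obtain ⟨s, hs⟩ := (inferInstance : Module.Finite Λ P).fg_top
  let e := HomologicalComplex.singleObjXSelf (.up ℤ) n P
  choose F hF using fun x : P => coproduct_element_eq_sum Y n ((e.inv ≫ f.f n) x)
  refine ⟨s.biUnion F, HomologicalComplex.from_single_hom_ext ?_⟩
  rw [← cancel_epi e.inv]
  refine ModuleCat.hom_ext (LinearMap.ext_on hs fun x hx => ?_)
  refine (hF x _ (Finset.subset_biUnion_of_mem F hx)).trans ?_
  have : e.inv ≫ (∑ p ∈ s.biUnion F, (f ≫ Sigma.π Y p) ≫ Sigma.ι Y p).f n =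
      ∑ p ∈ s.biUnion F, ((e.inv ≫ f.f n) ≫ (Sigma.π Y p).f n) ≫ (Sigma.ι Y p).f n := by
    rw [sum_f_eq, Preadditive.comp_sum]
    simp
  rw [this, ModuleCat.hom_sum, LinearMap.sum_apply]
  rfl

variable [HasDerivedCategory.{w} (ModuleCat.{0} Λ)]

open Classical in
lemma finiteFactor_single_of_projective {ι : Type} {Y : ι → DerivedCategory (ModuleCat.{0} Λ)}
    {S : DerivedCategory (ModuleCat.{0} Λ)} {inc : ∀ p, Y p ⟶ S} (h : IsCoprod inc)
    (P : ModuleCat.{0} Λ) [Projective P] [Module.Finite Λ P] (n : ℤ) :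
    FiniteFactor inc ((singleFunctor _ n).obj P) := by
  change FiniteFactor inc
    (Q.obj ((HomologicalComplex.single (ModuleCat.{0} Λ) (.up ℤ) n).obj P))
  intro f
  obtain ⟨S', ⟨eS⟩⟩ : ∃ L, Nonempty (Q.obj L ≅ S) := ⟨_, ⟨Q.objObjPreimageIso S⟩⟩
  have : ∀ p, ∃ (Y' : CochainComplex (ModuleCat.{0} Λ) ℤ) (e : Q.obj Y' ≅ Y p) (φ : Y' ⟶ S'),
      Q.map φ = e.hom ≫ inc p ≫ eS.inv := by
    intro p
    obtain ⟨X', s, hs, g, hg⟩ := right_fac ((Q.objObjPreimageIso (Y p)).hom ≫ inc p ≫ eS.inv)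
    exact ⟨X', asIso (Q.map s) ≪≫ Q.objObjPreimageIso (Y p), g, by simp [hg]⟩
  choose Y' e φ hφ using this
  obtain ⟨ψ, hψ⟩ := h.exists_desc (fun p => (e p).inv ≫ Q.map (Sigma.ι Y' p))
  have hid : ψ ≫ Q.map (Sigma.desc φ) ≫ eS.hom = 𝟙 _ := by
    refine h.hom_ext fun p => ?_
    rw [reassoc_of% hψ p, ← Functor.map_comp_assoc, Sigma.ι_desc, hφ]
    simp
  obtain ⟨χ, hχ⟩ := exists_Q_map_eq_of_isKProjective
    ((HomologicalComplex.single (ModuleCat.{0} Λ) (.up ℤ) n).obj P) (∐ Y') (f ≫ ψ)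
  obtain ⟨F, hF⟩ := hom_coproduct_eq_sum Y' n P χ
  refine ⟨F, fun p => Q.map (χ ≫ Sigma.π Y' p) ≫ (e p).hom, ?_⟩
  calc f = (f ≫ ψ) ≫ Q.map (Sigma.desc φ) ≫ eS.hom := by
        rw [Category.assoc, hid, Category.comp_id]
    _ = Q.map (χ ≫ Sigma.desc φ) ≫ eS.hom := by rw [← hχ, Functor.map_comp, Category.assoc]
    _ = _ := by
      conv_lhs => rw [hF]
      rw [Preadditive.sum_comp, Functor.map_sum, Preadditive.sum_comp]
      refine Finset.sum_congr rfl fun p _ => ?_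
      rw [Category.assoc _ _ (Sigma.desc φ), Sigma.ι_desc, Functor.map_comp, hφ]
      simp

lemma finiteFactor_single_of_small {ι : Type t} [Small.{0} ι]
    {Y : ι → DerivedCategory (ModuleCat.{0} Λ)}
    {S : DerivedCategory (ModuleCat.{0} Λ)} {inc : ∀ p, Y p ⟶ S} (h : IsCoprod inc)
    (P : ModuleCat.{0} Λ) [Projective P] [Module.Finite Λ P] (n : ℤ) :
    FiniteFactor inc ((singleFunctor _ n).obj P) :=
  .of_reindex (equivShrink ι).symm
    (finiteFactor_single_of_projective (h.reindex (equivShrink ι).symm) P n)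

end Modules

section

variable {D : Type u} [Category.{v} D] [Preadditive D]

open Classical in
lemma exists_eq_sum_add {ι : Type t} {Y : ι → D} {S : D} {inc : ∀ p, Y p ⟶ S} {C : D}
    {f f' : C ⟶ S}
    (h : ∃ (F : Finset ι) (g : ∀ p, C ⟶ Y p), f = ∑ p ∈ F, g p ≫ inc p)
    (h' : ∃ (F : Finset ι) (g : ∀ p, C ⟶ Y p), f' = ∑ p ∈ F, g p ≫ inc p) :
    ∃ (F : Finset ι) (g : ∀ p, C ⟶ Y p), f + f' = ∑ p ∈ F, g p ≫ inc p := by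
  obtain ⟨F, g, rfl⟩ := h
  obtain ⟨F', g', rfl⟩ := h'
  refine ⟨F ∪ F', fun p => (if p ∈ F then g p else 0) + (if p ∈ F' then g' p else 0), ?_⟩
  simp only [Preadditive.add_comp, Finset.sum_add_distrib]
  congr 1
  · rw [← Finset.sum_subset (Finset.subset_union_left (s₁ := F) (s₂ := F'))]
    · exact Finset.sum_congr rfl fun p hp => by rw [if_pos hp]
    · intro p _ hp
      rw [if_neg hp, zero_comp]
  · rw [← Finset.sum_subset (Finset.subset_union_right (s₁ := F) (s₂ := F'))]
    · exact Finset.sum_congr rfl fun p hp => by rw [if_pos hp]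
    · intro p _ hp
      rw [if_neg hp, zero_comp]

variable [HasZeroObject D] [HasShift D ℤ] [∀ n : ℤ, (shiftFunctor D n).Additive]
  [Pretriangulated D]

lemma exists_extension_of_invRotate {T : Triangle D} (hT : T ∈ distTriang D) {W : D}
    (f : T.obj₁ ⟶ W) (hf : T.invRotate.mor₁ ≫ f = 0) : ∃ g : T.obj₂ ⟶ W, f = T.mor₁ ≫ g :=
  Triangle.yoneda_exact₂ _ (inv_rot_of_distTriang _ hT) f hf

open Classical in
lemma FiniteFactor.of_distTriang {ι : Type t} {Y : ι → D} {S : D} {inc : ∀ p, Y p ⟶ S}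
    (h : IsCoprod inc) {T : Triangle D} (hT : T ∈ distTriang D) (h₁ : FiniteFactor inc T.obj₁)
    (h₃ : FiniteFactor inc T.obj₃) : FiniteFactor inc T.obj₂ := by
  intro f
  obtain ⟨π, hπ, hπ'⟩ := h.exists_proj
  obtain ⟨F, g, hg⟩ := h₁ (T.mor₁ ≫ f)
  have hF : ∀ p ∈ F, (T.mor₁ ≫ f) ≫ π p = g p := by
    intro p hp
    rw [hg, Preadditive.sum_comp, Finset.sum_eq_single_of_mem p hp]
    · rw [Category.assoc, hπ, Category.comp_id]
    · intro q _ hq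
      rw [Category.assoc, hπ' _ _ hq.symm, comp_zero]
  have : ∃ u : T.obj₃ ⟶ S, f - ∑ p ∈ F, (f ≫ π p) ≫ inc p = T.mor₂ ≫ u := by
    apply Triangle.yoneda_exact₂ _ hT
    rw [Preadditive.comp_sub, Preadditive.comp_sum, sub_eq_zero]
    conv_lhs => rw [hg]
    exact Finset.sum_congr rfl fun p hp => by rw [← hF p hp]; simp
  obtain ⟨u, hu⟩ := this
  obtain ⟨G, k, hk⟩ := h₃ u
  rw [← sub_add_cancel f (∑ p ∈ F, (f ≫ π p) ≫ inc p), hu]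
  refine exists_eq_sum_add ⟨G, fun p => T.mor₂ ≫ k p, ?_⟩ ⟨F, fun p => f ≫ π p, rfl⟩
  rw [hk, Preadditive.comp_sum]
  simp

end

section Noetherian

variable {Λ : Type} [Ring Λ]

lemma finite_of_exact [IsNoetherianRing Λ] {S : ShortComplex (ModuleCat.{0} Λ)} (hS : S.Exact)
    (h₁ : Module.Finite Λ S.X₁) (h₃ : Module.Finite Λ S.X₃) : Module.Finite Λ S.X₂ := by
  have : Module.Finite Λ (LinearMap.ker S.g.hom) := by
    rw [← hS.moduleCat_range_eq_ker]
    infer_instance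
  have : Module.Finite Λ (S.X₂ ⧸ LinearMap.ker S.g.hom) :=
    Module.Finite.equiv S.g.hom.quotKerEquivRange.symm
  exact .of_submodule_quotient (LinearMap.ker S.g.hom)

lemma finite_of_isZero {M : ModuleCat.{0} Λ} (hM : IsZero M) : Module.Finite Λ M := by
  have := ModuleCat.subsingleton_of_isZero hM
  infer_instance

variable [HasDerivedCategory.{w} (ModuleCat.{0} Λ)]

/-- All the homology modules of `X` are finitely generated. -/
def HasFiniteHomology (X : DerivedCategory (ModuleCat.{0} Λ)) : Prop :=
  ∀ n, Module.Finite Λ ((homologyFunctor (ModuleCat.{0} Λ) n).obj X)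

lemma HasFiniteHomology.of_iso {X Y : DerivedCategory (ModuleCat.{0} Λ)}
    (h : HasFiniteHomology X) (e : X ≅ Y) : HasFiniteHomology Y := fun n =>
  have := h n
  Module.Finite.equiv ((homologyFunctor (ModuleCat.{0} Λ) n).mapIso e).toLinearEquiv

lemma hasFiniteHomology_single (M : ModuleCat.{0} Λ) [Module.Finite Λ M] (n : ℤ) :
    HasFiniteHomology ((singleFunctor _ n).obj M) := by
  intro i
  obtain h | rfl | h := lt_trichotomy i n
  · exact finite_of_isZero (isZero_of_isGE ((singleFunctor _ n).obj M) n i h)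
  · exact Module.Finite.equiv (singleHomologyIso i M).toLinearEquiv
  · exact finite_of_isZero (isZero_of_isLE ((singleFunctor _ n).obj M) n i h)

lemma HasFiniteHomology.obj₃ [IsNoetherianRing Λ]
    {T : Triangle (DerivedCategory (ModuleCat.{0} Λ))} (hT : T ∈ distTriang _)
    (h₁ : HasFiniteHomology T.obj₁) (h₂ : HasFiniteHomology T.obj₂) :
    HasFiniteHomology T.obj₃ := fun n =>
  finite_of_exact (HomologySequence.exact₃ T hT n (n + 1)) (h₂ n) (h₁ (n + 1))

lemma HasFiniteHomology.obj₁ [IsNoetherianRing Λ]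
    {T : Triangle (DerivedCategory (ModuleCat.{0} Λ))} (hT : T ∈ distTriang _)
    (h₂ : HasFiniteHomology T.obj₂) (h₃ : HasFiniteHomology T.obj₃) :
    HasFiniteHomology T.obj₁ := fun n =>
  finite_of_exact (HomologySequence.exact₁ T hT (n - 1) n) (h₃ (n - 1)) (h₂ n)

lemma exists_epi_homology (X : DerivedCategory (ModuleCat.{0} Λ)) (n : ℤ)
    [Module.Finite Λ ((homologyFunctor (ModuleCat.{0} Λ) n).obj X)] :
    ∃ (P : ModuleCat.{0} Λ) (_ : Projective P) (_ : Module.Finite Λ P)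
      (f : (singleFunctor _ n).obj P ⟶ X), Epi ((homologyFunctor (ModuleCat.{0} Λ) n).map f) := by
  obtain ⟨k, p, hp⟩ := Module.Finite.exists_fin' Λ ((homologyFunctor (ModuleCat.{0} Λ) n).obj X)
  have : Projective (ModuleCat.of Λ (Fin k → Λ)) :=
    ModuleCat.projective_of_free (Pi.basisFun Λ (Fin k))
  obtain ⟨f, hf⟩ := singleEval_surjective (P := ModuleCat.of Λ (Fin k → Λ)) (ModuleCat.ofHom p)
  have : Epi (singleEval f) := by
    rw [hf]
    exact (ModuleCat.epi_iff_surjective _).2 hp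
  have h : Epi ((homologyFunctor (ModuleCat.{0} Λ) n).map f) := epi_of_epi_fac
    (show _ = singleEval f from rfl)
  exact ⟨_, ‹_›, inferInstanceAs (Module.Finite Λ (Fin k → Λ)), f, h⟩

theorem devissage [IsNoetherianRing Λ] (Pr : DerivedCategory (ModuleCat.{0} Λ) → Prop) (a : ℤ)
    (h₀ : ∀ C, C.IsLE a → Pr C)
    (hs : ∀ (n : ℤ) (P : ModuleCat.{0} Λ) [Projective P] [Module.Finite Λ P],
      Pr ((singleFunctor _ n).obj P))
    (ht : ∀ T ∈ distTriang (DerivedCategory (ModuleCat.{0} Λ)), Pr T.obj₁ → Pr T.obj₃ → Pr T.obj₂)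
    (C : DerivedCategory (ModuleCat.{0} Λ)) (b : ℤ) (hb : C.IsLE b) (hC : HasFiniteHomology C) :
    Pr C := by
  obtain ⟨n, hn⟩ : ∃ n : ℕ, b ≤ a + n := ⟨(b - a).toNat, by lia⟩
  induction n generalizing b C with
  | zero => exact h₀ C (TStructure.t.isLE_of_le C b a (by simpa using hn))
  | succ n ih =>
    have := hC b
    obtain ⟨P, _, _, f, hf⟩ := exists_epi_homology C b
    obtain ⟨C', g, h, hT⟩ := distinguished_cocone_triangle f
    refine ht _ hT (hs b P) (ih C' (b - 1) ?_
      (.obj₃ hT (hasFiniteHomology_single P b) hC) (by push_cast at hn; lia))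
    rw [isLE_iff]
    intro i hi
    refine (HomologySequence.exact₃ _ hT i (i + 1)).isZero_X₂ ?_
      ((isZero_of_isLE ((singleFunctor _ b).obj P) b (i + 1) (by lia)).eq_of_tgt _ _)
    obtain rfl | hi := (show b = i ∨ b < i by lia)
    · exact (HomologySequence.epi_homologyMap_mor₁_iff _ hT b).1 hf
    · exact (isZero_of_isLE C b i hi).eq_of_src _ _

lemma small_hom [IsNoetherianRing Λ] (C Y : DerivedCategory (ModuleCat.{0} Λ)) (a b : ℤ)
    (hb : C.IsLE b) (hC : HasFiniteHomology C) (hY : Y.IsGE a) : Small.{0} (C ⟶ Y) := by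
  refine devissage (fun C => Small.{0} (C ⟶ Y)) (a - 1) (fun C hC => ?_) (fun n P _ _ => ?_)
    (fun T hT h₁ h₃ => ?_) C b hb hC
  · have : Subsingleton (C ⟶ Y) := ⟨fun f g => by
      rw [TStructure.t.zero f (a - 1) a, TStructure.t.zero g (a - 1) a]⟩
    infer_instance
  · obtain ⟨L, ⟨e⟩⟩ : ∃ L, Nonempty (Q.obj L ≅ Y) := ⟨_, ⟨Q.objObjPreimageIso Y⟩⟩
    refine small_of_surjective
      (f := fun φ : (HomologicalComplex.single (ModuleCat.{0} Λ) (.up ℤ) n).obj P ⟶ L =>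
        (show (singleFunctor _ n).obj P ⟶ Y from Q.map φ ≫ e.hom)) fun g => ?_
    obtain ⟨φ, hφ⟩ := exists_Q_map_eq_of_isKProjective
      ((HomologicalComplex.single (ModuleCat.{0} Λ) (.up ℤ) n).obj P) L (g ≫ e.inv)
    exact ⟨φ, ((congrArg (· ≫ e.hom) hφ).trans (Category.assoc _ _ _)).trans (by simp)⟩
  · classical
    let s : (T.obj₁ ⟶ Y) → (T.obj₂ ⟶ Y) := fun u =>
      if h : ∃ f, T.mor₁ ≫ f = u then h.choose else 0
    have hs : ∀ f, T.mor₁ ≫ s (T.mor₁ ≫ f) = T.mor₁ ≫ f := by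
      intro f
      have h : ∃ f', T.mor₁ ≫ f' = T.mor₁ ≫ f := ⟨f, rfl⟩
      simp only [s, dif_pos h, h.choose_spec]
    have : ∀ f : T.obj₂ ⟶ Y, ∃ g : T.obj₃ ⟶ Y, f - s (T.mor₁ ≫ f) = T.mor₂ ≫ g := fun f =>
      Triangle.yoneda_exact₂ _ hT _ (by rw [Preadditive.comp_sub, hs, sub_self])
    choose k hk using this
    refine small_of_injective (β := (T.obj₁ ⟶ Y) × (T.obj₃ ⟶ Y))
      (f := fun f => (T.mor₁ ≫ f, k f)) fun f f' hff' => ?_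
    simp only [Prod.mk.injEq] at hff'
    have h := hk f
    rw [hff'.1, hff'.2, ← hk f'] at h
    exact sub_left_injective h

instance projective_self : Projective (ModuleCat.of Λ Λ) :=
  ModuleCat.projective_of_free (Module.Basis.singleton Unit Λ)

lemma isZero_homology_of_hom_single_eq_zero (X : DerivedCategory (ModuleCat.{0} Λ)) (n : ℤ)
    (h : ∀ f : (singleFunctor _ n).obj (ModuleCat.of Λ Λ) ⟶ X, f = 0) :
    IsZero ((homologyFunctor (ModuleCat.{0} Λ) n).obj X) := by
  have : Subsingleton ((homologyFunctor (ModuleCat.{0} Λ) n).obj X) := by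
    refine subsingleton_of_forall_eq 0 fun x => ?_
    obtain ⟨f, hf⟩ := singleEval_surjective (P := ModuleCat.of Λ Λ) (X := X) (n := n)
      (ModuleCat.ofHom (LinearMap.toSpanSingleton Λ _ x))
    rw [h f, singleEval_zero] at hf
    have := congrArg (fun φ => φ.hom (1 : Λ)) hf
    simpa using this.symm
  exact ModuleCat.isZero_of_subsingleton _

lemma isGE_of_hom_single_eq_zero (X : DerivedCategory (ModuleCat.{0} Λ)) (a : ℤ)
    (h : ∀ n < a, ∀ f : (singleFunctor _ n).obj (ModuleCat.of Λ Λ) ⟶ X, f = 0) : X.IsGE a := by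
  rw [isGE_iff]
  exact fun i hi => isZero_homology_of_hom_single_eq_zero X i (h i hi)

lemma isLE_of_hom_single_eq_zero (X : DerivedCategory (ModuleCat.{0} Λ)) (b : ℤ)
    (h : ∀ n > b, ∀ f : (singleFunctor _ n).obj (ModuleCat.of Λ Λ) ⟶ X, f = 0) : X.IsLE b := by
  rw [isLE_iff]
  exact fun i hi => isZero_homology_of_hom_single_eq_zero X i (h i hi)

lemma IsCoprod.isGE {ι : Type t} [Small.{0} ι] {Y : ι → DerivedCategory (ModuleCat.{0} Λ)}
    {S : DerivedCategory (ModuleCat.{0} Λ)} {inc : ∀ p, Y p ⟶ S} (h : IsCoprod inc) (a : ℤ)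
    (hY : ∀ p, (Y p).IsGE a) : S.IsGE a := by
  refine isGE_of_hom_single_eq_zero _ _ fun n hn f => ?_
  have : Module.Finite Λ (ModuleCat.of Λ Λ) := inferInstanceAs (Module.Finite Λ Λ)
  obtain ⟨F, g, rfl⟩ := finiteFactor_single_of_small h (ModuleCat.of Λ Λ) n f
  refine Finset.sum_eq_zero fun p _ => ?_
  have := hY p
  rw [TStructure.t.zero (g p) n a, zero_comp]

lemma IsCoprod.finiteFactor [IsNoetherianRing Λ] {ι : Type t} [Small.{0} ι]
    {Y : ι → DerivedCategory (ModuleCat.{0} Λ)}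
    {S : DerivedCategory (ModuleCat.{0} Λ)} {inc : ∀ p, Y p ⟶ S} (h : IsCoprod inc) (a : ℤ)
    (hY : ∀ p, (Y p).IsGE a) (C : DerivedCategory (ModuleCat.{0} Λ)) (b : ℤ) (hb : C.IsLE b)
    (hC : HasFiniteHomology C) : FiniteFactor inc C := by
  have hS := h.isGE a hY
  refine devissage _ (a - 1) (fun C hC f => ⟨∅, 0, ?_⟩)
    (fun n P _ _ => finiteFactor_single_of_small h P n)
    (fun T hT h₁ h₃ => .of_distTriang h hT h₁ h₃) C b hb hC
  rw [TStructure.t.zero f (a - 1) a, Finset.sum_empty]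

end Noetherian

section Linear

variable (K : Type) [Field K] (Λ : Type) [Ring Λ] [Algebra K Λ]
  [HasDerivedCategory (ModuleCat.{0} Λ)]
  [CategoryTheory.Linear K (DerivedCategory (ModuleCat.{0} Λ))]
  [(Qh (C := ModuleCat.{0} Λ)).Linear K]

lemma shiftFunctor_linear (n : ℤ) :
    (shiftFunctor (DerivedCategory (ModuleCat.{0} Λ)) n).Linear K :=
  Shift.linear_of_localization K Qh (HomotopyCategory.subcategoryAcyclic (ModuleCat.{0} Λ)).trW n

lemma singleFunctor_linear (n : ℤ) : (singleFunctor (ModuleCat.{0} Λ) n).Linear K :=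
  inferInstanceAs (Functor.Linear K (HomotopyCategory.singleFunctor (ModuleCat.{0} Λ) n ⋙ Qh))

end Linear

section Db

variable {Λ : Type} [Ring Λ] [HasDerivedCategory (ModuleCat.{0} Λ)]

lemma IsDbObject.exists_bounds [IsNoetherianRing Λ] {C : DerivedCategory (ModuleCat.{0} Λ)}
    (h : IsDbObject Λ C) :
    (∃ a, C.IsGE a) ∧ (∃ b, C.IsLE b) ∧ HasFiniteHomology C := by
  obtain ⟨M, ⟨a, b, hab⟩, hM, ⟨e⟩⟩ := h
  have hZ : ∀ n, (n < a ∨ b < n) → IsZero ((homologyFunctor _ n).obj C) := fun n hn =>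
    IsZero.of_iso (ShortComplex.isZero_homology_of_isZero_X₂ _ (hab n hn))
      ((homologyFunctor _ n).mapIso e.symm ≪≫ (homologyQIso M n).symm)
  refine ⟨⟨a, ?_⟩, ⟨b, ?_⟩, HasFiniteHomology.of_iso (fun n => ?_) e⟩
  · rw [isGE_iff]
    exact fun i hi => hZ i (.inl hi)
  · rw [isLE_iff]
    exact fun i hi => hZ i (.inr hi)
  · have := hM n
    have h₁ : Module.Finite Λ (M.cycles n : ModuleCat.{0} Λ) :=
      Module.Finite.of_injective (HomologicalComplex.iCycles M n).hom
        ((ModuleCat.mono_iff_injective _).1 inferInstance)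
    have h₂ : Module.Finite Λ (M.homology n : ModuleCat.{0} Λ) :=
      Module.Finite.of_surjective (HomologicalComplex.homologyπ M n).hom
        ((ModuleCat.epi_iff_surjective _).1 inferInstance)
    exact Module.Finite.equiv (homologyQIso M n).toLinearEquiv

end Db

section Collection

variable {K : Type} [Field K] {Λ : Type} [Ring Λ]
  [HasDerivedCategory (ModuleCat.{0} Λ)]
  [CategoryTheory.Linear K (DerivedCategory (ModuleCat.{0} Λ))]
  {r : ℕ} {X : Fin r → DerivedCategory (ModuleCat.{0} Λ)}

lemma IsSimpleMindedCollection.isDbObject_shift (hX : IsSimpleMindedCollection K Λ r X)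
    (j : Fin r) (m : ℤ) : IsDbObject Λ ((X j)⟦m⟧) :=
  (hX.generates _).2 (.shift _ _ (.of _ ⟨j, rfl⟩))

lemma IsSimpleMindedCollection.exists_isGE [IsNoetherianRing Λ]
    (hX : IsSimpleMindedCollection K Λ r X) : ∃ a, ∀ j, (X j).IsGE a := by
  choose a ha using fun j => (hX.mem_Db j).exists_bounds.1
  obtain ⟨b, hb⟩ := (Set.finite_range a).bddBelow
  exact ⟨b, fun j => TStructure.t.isGE_of_ge _ _ _ (hb ⟨j, rfl⟩)⟩

lemma IsSimpleMindedCollection.hom_shift_eq_zero (hX : IsSimpleMindedCollection K Λ r X)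
    {j l : Fin r} {m m' : ℤ} (h : m' < m) (f : (X j)⟦m⟧ ⟶ (X l)⟦m'⟧) : f = 0 := by
  let e := (shiftFunctorAdd' (DerivedCategory (ModuleCat.{0} Λ)) (m' - m) m m' (by lia)).app (X l)
  obtain ⟨g, hg⟩ := (shiftFunctor _ m).map_surjective (f ≫ e.hom)
  rw [← cancel_mono e.hom, ← hg, hX.hom_neg_shift_vanish j l (m' - m) (by lia) g]
  simp

lemma IsSimpleMindedCollection.hom_shift_eq_zero_of_ne (hX : IsSimpleMindedCollection K Λ r X)
    {j l : Fin r} (h : j ≠ l) {m : ℤ} (f : (X j)⟦m⟧ ⟶ (X l)⟦m⟧) : f = 0 := by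
  obtain ⟨g, rfl⟩ := (shiftFunctor _ m).map_surjective f
  rw [hX.hom_ne_vanish _ _ h g, Functor.map_zero]

variable [Algebra K Λ] [(Qh (C := ModuleCat.{0} Λ)).Linear K]

lemma IsSimpleMindedCollection.end_shift (hX : IsSimpleMindedCollection K Λ r X)
    (j : Fin r) {m : ℤ} (f : (X j)⟦m⟧ ⟶ (X j)⟦m⟧) : ∃ c : K, f = c • 𝟙 _ := by
  have hne : 𝟙 (X j) ≠ 0 := by
    intro h
    have : Subsingleton (X j ⟶ X j) := ⟨fun f g => by
      rw [← Category.id_comp f, ← Category.id_comp g, h, zero_comp, zero_comp]⟩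
    have := Module.finrank_zero_of_subsingleton (R := K) (M := X j ⟶ X j)
    rw [hX.end_dim j] at this
    exact one_ne_zero this
  obtain ⟨g, rfl⟩ := (shiftFunctor _ m).map_surjective f
  obtain ⟨c, rfl⟩ := (finrank_eq_one_iff_of_nonzero' (𝟙 (X j)) hne).1 (hX.end_dim j) g
  have := shiftFunctor_linear K Λ m
  exact ⟨c, by rw [Functor.map_smul, CategoryTheory.Functor.map_id]⟩

end Collection

section Shift

variable {D : Type*} [Category D] [Preadditive D] [HasZeroObject D] [HasShift D ℤ]
  [∀ n : ℤ, (shiftFunctor D n).Additive] [Pretriangulated D]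

/-- If no nonzero morphism from `A⟦m - 1⟧` to the source of the first map of a distinguished
triangle is killed by this map, then all morphisms from `A⟦m⟧` to the cone lift. -/
lemma exists_lift_of_comp_eq_zero {T : Triangle D} (hT : T ∈ distTriang D) (A : D) (m : ℤ)
    (hA : ∀ h : A⟦m - 1⟧ ⟶ T.obj₁, h ≫ T.mor₁ = 0 → h = 0) (f : A⟦m⟧ ⟶ T.obj₃) :
    ∃ g : A⟦m⟧ ⟶ T.obj₂, f = g ≫ T.mor₂ := by
  let e := (shiftFunctorAdd' D (m - 1) 1 m (by lia)).app A
  obtain ⟨h, hh⟩ := (shiftFunctor D (1 : ℤ)).map_surjective (e.inv ≫ f ≫ T.mor₃)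
  refine Triangle.coyoneda_exact₃ _ hT f ?_
  rw [← cancel_epi e.inv, ← hh, hA h, Functor.map_zero, comp_zero]
  apply (shiftFunctor D (1 : ℤ)).map_injective
  rw [Functor.map_comp, hh, Functor.map_zero, Category.assoc, Category.assoc,
    comp_distTriang_mor_zero₃₁ _ hT, comp_zero, comp_zero]

end Shift

namespace RickardData

variable {K : Type} [Field K] {Λ : Type} [Ring Λ]
  [HasDerivedCategory (ModuleCat.{0} Λ)]
  [CategoryTheory.Linear K (DerivedCategory (ModuleCat.{0} Λ))]
  {r : ℕ} {X : Fin r → DerivedCategory (ModuleCat.{0} Λ)} (R : RickardData K r X)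

/-- The index set of the coproduct `Z_i⁽ⁿ⁾`. -/
abbrev Index (i : Fin r) (n : ℕ) :=
  Σ (j : Fin r) (m : ℤ), {f : (X j)⟦m⟧ ⟶ R.Xs i n // m < 0 ∧ f ∈ R.B j m i n}

lemma isCoprod_Z (i : Fin r) (n : ℕ) : IsCoprod (R.inc i n) :=
  let ⟨h⟩ := R.isColimitZ i n
  .of_isColimit h

lemma isCoprod_CP (i : Fin r) : IsCoprod (R.cinc i) :=
  let ⟨h⟩ := R.isColimitCP i
  .of_isColimit h

lemma cinc_toT (i : Fin r) (n : ℕ) :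
    R.cinc i n ≫ R.toT i = R.β i n ≫ R.cinc i (n + 1) ≫ R.toT i := by
  have h : R.oneSubβ i ≫ R.toT i = 0 := comp_distTriang_mor_zero₁₂ _ (R.distT i)
  have h' : R.cinc i n ≫ R.oneSubβ i ≫ R.toT i = 0 := by rw [h, comp_zero]
  rwa [← Category.assoc, R.cinc_oneSubβ, Preadditive.sub_comp, sub_eq_zero, Category.assoc] at h'

lemma comp_β_eq_zero {i j : Fin r} {n : ℕ} {m : ℤ} (hm : m < 0) (f : (X j)⟦m⟧ ⟶ R.Xs i n) :
    f ≫ R.β i n = 0 := by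
  have hf : f ∈ Submodule.span K (R.B j m i n) := by rw [R.B_span j m i n hm]; trivial
  induction hf using Submodule.span_induction with
  | mem b hb =>
    have h : R.α i n ≫ R.β i n = 0 := comp_distTriang_mor_zero₁₂ _ (R.dist i n)
    have h' := R.inc_α i n ⟨j, m, b, hm, hb⟩
    dsimp at h'
    rw [← h', Category.assoc, h, comp_zero]
  | zero => exact zero_comp
  | add f g _ _ hf hg => rw [Preadditive.add_comp, hf, hg, add_zero]
  | smul c f _ hf => rw [Linear.smul_comp, hf, smul_zero]

lemma isGE_index {a : ℤ} (ha : ∀ j, (X j).IsGE a) {i : Fin r} {n : ℕ} (p : R.Index i n) :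
    ((X p.1)⟦p.2.1⟧).IsGE (a + 1) := by
  have := ha p.1
  have := p.2.2.2.1
  have := TStructure.t.isGE_shift (X p.1) a p.2.1 (a - p.2.1)
  exact TStructure.t.isGE_of_ge _ (a + 1) (a - p.2.1) (by lia)

lemma finite_hom_Xs_zero [Algebra K Λ] [(Qh (C := ModuleCat.{0} Λ)).Linear K]
    (hX : IsSimpleMindedCollection K Λ r X) (i j : Fin r) :
    Module.Finite K ((X j)⟦(0 : ℤ)⟧ ⟶ R.Xs i 0) := by
  let e : R.Xs i 0 ≅ (X i)⟦(0 : ℤ)⟧ := eqToIso (R.Xs_zero i) ≪≫ ((shiftFunctorZero _ ℤ).app _).symm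
  obtain rfl | hij := eq_or_ne j i
  · refine Module.Finite.of_surjective (LinearMap.toSpanSingleton K _ e.inv) fun f => ?_
    obtain ⟨c, hc⟩ := hX.end_shift j (f ≫ e.hom)
    refine ⟨c, ?_⟩
    rw [LinearMap.toSpanSingleton_apply, ← cancel_mono e.hom, hc, Linear.smul_comp, e.inv_hom_id]
  · have : Subsingleton ((X j)⟦(0 : ℤ)⟧ ⟶ R.Xs i 0) := subsingleton_of_forall_eq 0 fun f => by
      rw [← cancel_mono e.hom, hX.hom_shift_eq_zero_of_ne hij (f ≫ e.hom), zero_comp]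
    infer_instance

variable [IsNoetherianRing Λ]

lemma small_index
    (hX : IsSimpleMindedCollection K Λ r X) {a : ℤ} {i : Fin r} {n : ℕ} (h : (R.Xs i n).IsGE a) :
    Small.{0} (R.Index i n) := by
  have (j : Fin r) (m : ℤ) : Small.{0} ((X j)⟦m⟧ ⟶ R.Xs i n) := by
    obtain ⟨-, ⟨b, hb⟩, hf⟩ := (hX.isDbObject_shift j m).exists_bounds
    exact small_hom _ _ a b hb hf h
  infer_instance

lemma isGE_Z
    (hX : IsSimpleMindedCollection K Λ r X) {a : ℤ} (ha : ∀ j, (X j).IsGE a) {i : Fin r} {n : ℕ}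
    (h : (R.Xs i n).IsGE a) :
    (R.Z i n).IsGE (a + 1) :=
  have := R.small_index hX h
  (R.isCoprod_Z i n).isGE (a + 1) (R.isGE_index ha)

lemma isGE_Xs
    (hX : IsSimpleMindedCollection K Λ r X) {a : ℤ} (ha : ∀ j, (X j).IsGE a) (i : Fin r) (n : ℕ) :
    (R.Xs i n).IsGE a := by
  induction n with
  | zero => rw [R.Xs_zero]; exact ha i
  | succ n ih =>
    have := R.isGE_Z hX ha ih
    exact TStructure.t.isGE₂ _ (rot_of_distTriang _ (R.dist i n)) a ih
      (TStructure.t.isGE_shift (R.Z i n) (a + 1) 1 a)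

lemma isGE_T
    (hX : IsSimpleMindedCollection K Λ r X) {a : ℤ} (ha : ∀ j, (X j).IsGE a) (i : Fin r) :
    (R.T i).IsGE (a - 1) := by
  have := (R.isCoprod_CP i).isGE a (R.isGE_Xs hX ha i)
  exact TStructure.t.isGE₂ _ (rot_of_distTriang _ (R.distT i)) (a - 1)
    (TStructure.t.isGE_of_ge (R.CP i) (a - 1) a)
    (TStructure.t.isGE_shift (R.CP i) a 1 (a - 1))

lemma finiteFactor_Z
    (hX : IsSimpleMindedCollection K Λ r X) (i j : Fin r) (n : ℕ) (m : ℤ) : FiniteFactor (R.inc i n)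
    ((X j)⟦m⟧) := by
  obtain ⟨a, ha⟩ := hX.exists_isGE
  have := R.small_index hX (R.isGE_Xs hX ha i n)
  obtain ⟨-, ⟨b, hb⟩, hf⟩ := (hX.isDbObject_shift j m).exists_bounds
  exact (R.isCoprod_Z i n).finiteFactor (a + 1) (R.isGE_index ha) _ b hb hf

lemma finiteFactor_CP
    (hX : IsSimpleMindedCollection K Λ r X) (i j : Fin r) (m : ℤ) : FiniteFactor (R.cinc i)
    ((X j)⟦m⟧) := by
  obtain ⟨a, ha⟩ := hX.exists_isGE
  obtain ⟨-, ⟨b, hb⟩, hf⟩ := (hX.isDbObject_shift j m).exists_bounds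
  exact (R.isCoprod_CP i).finiteFactor a (R.isGE_Xs hX ha i) _ b hb hf

lemma hom_CP_eq_zero
    (hX : IsSimpleMindedCollection K Λ r X) {i j : Fin r} {m : ℤ} (h : (X j)⟦m⟧ ⟶ R.CP i)
    (hh : h ≫ R.oneSubβ i = 0) :
    h = 0 := by
  obtain ⟨π, hπ, hπ'⟩ := (R.isCoprod_CP i).exists_proj
  have h₀ : R.oneSubβ i ≫ π 0 = π 0 := (R.isCoprod_CP i).hom_ext fun k => by
    rw [← Category.assoc, R.cinc_oneSubβ, Preadditive.sub_comp, Category.assoc,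
      hπ' 0 (k + 1) (by lia), comp_zero, sub_zero]
  have h₁ : ∀ n, R.oneSubβ i ≫ π (n + 1) = π (n + 1) - π n ≫ R.β i n := fun n =>
    (R.isCoprod_CP i).hom_ext fun k => by
      rw [← Category.assoc, R.cinc_oneSubβ, Preadditive.sub_comp, Category.assoc,
        Preadditive.comp_sub]
      congr 1
      obtain rfl | hk := eq_or_ne n k
      · rw [hπ, ← Category.assoc, hπ, Category.comp_id, Category.id_comp]
      · rw [hπ' (n + 1) (k + 1) (by lia), ← Category.assoc, hπ' n k hk, comp_zero, zero_comp]
  have h₂ : ∀ n, h ≫ π n = 0 := by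
    intro n
    induction n with
    | zero => rw [← h₀, ← Category.assoc, hh, zero_comp]
    | succ n ih =>
      have h₃ : h ≫ R.oneSubβ i ≫ π (n + 1) = h ≫ (π (n + 1) - π n ≫ R.β i n) := by rw [h₁]
      rw [← Category.assoc, hh, zero_comp, Preadditive.comp_sub, ← Category.assoc, ih, zero_comp,
        sub_zero] at h₃
      exact h₃.symm
  obtain ⟨F, g, rfl⟩ := R.finiteFactor_CP hX i j m h
  refine Finset.sum_eq_zero fun n hn => ?_
  have h₃ := h₂ n
  rw [Preadditive.sum_comp, Finset.sum_eq_single_of_mem n hn, Category.assoc, hπ,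
    Category.comp_id] at h₃
  · rw [h₃, zero_comp]
  · intro k _ hk
    rw [Category.assoc, hπ' n k hk.symm, comp_zero]

lemma exists_eq_sum_toT
    (hX : IsSimpleMindedCollection K Λ r X) {i j : Fin r} {m : ℤ} (f : (X j)⟦m⟧ ⟶ R.T i) :
    ∃ (F : Finset ℕ) (g : ∀ n, (X j)⟦m⟧ ⟶ R.Xs i n),
      f = ∑ n ∈ F, g n ≫ R.cinc i n ≫ R.toT i := by
  obtain ⟨g, hg⟩ := exists_lift_of_comp_eq_zero (R.distT i) (X j) m
    (fun h hh => R.hom_CP_eq_zero hX h hh) f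
  obtain ⟨F, k, rfl⟩ := R.finiteFactor_CP hX i j m g
  refine ⟨F, k, (show f = (∑ p ∈ F, k p ≫ R.cinc i p) ≫ R.toT i from hg).trans ?_⟩
  simp only [Preadditive.sum_comp, Category.assoc]

lemma hom_T_eq_zero_of_neg
    (hX : IsSimpleMindedCollection K Λ r X) {i j : Fin r} {m : ℤ} (hm : m < 0)
    (f : (X j)⟦m⟧ ⟶ R.T i) :
    f = 0 := by
  obtain ⟨F, g, rfl⟩ := R.exists_eq_sum_toT hX f
  refine Finset.sum_eq_zero fun n _ => ?_
  rw [R.cinc_toT, ← Category.assoc, R.comp_β_eq_zero hm, zero_comp]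

variable [Algebra K Λ] [(Qh (C := ModuleCat.{0} Λ)).Linear K]

open Classical in
lemma hom_Z_eq_zero
    (hX : IsSimpleMindedCollection K Λ r X) {i j : Fin r} {n : ℕ} {m : ℤ} (hm : -1 ≤ m)
    (h : (X j)⟦m⟧ ⟶ R.Z i n)
    (hh : h ≫ R.α i n = 0) : h = 0 := by
  obtain ⟨F, g, rfl⟩ := R.finiteFactor_Z hX i j n m h
  obtain hm | rfl := (show 0 ≤ m ∨ m = -1 by lia)
  · refine Finset.sum_eq_zero fun p _ => ?_
    have := p.2.2.2.1
    rw [hX.hom_shift_eq_zero (by lia) (g p), zero_comp]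
  · let e : R.B j (-1) i n → R.Index i n := fun b => ⟨j, -1, b.1, by lia, b.2⟩
    have he : Function.Injective e := by
      rintro ⟨b, hb⟩ ⟨b', hb'⟩ h
      simpa [e] using h
    have hg : ∀ p, p ∉ Set.range e → g p = 0 := by
      rintro ⟨l, m, b, hm, hb⟩ hp
      obtain hm' | rfl := (show m < -1 ∨ m = -1 by lia)
      · exact hX.hom_shift_eq_zero hm' _
      · obtain rfl | hl := eq_or_ne j l
        · exact (hp ⟨⟨b, hb⟩, rfl⟩).elim
        · exact hX.hom_shift_eq_zero_of_ne hl _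
    choose c hc using fun b : R.B j (-1) i n => hX.end_shift j (g (e b))
    have hsum : ∀ {W : DerivedCategory (ModuleCat.{0} Λ)}
        (u : ∀ p : R.Index i n, (X p.1)⟦p.2.1⟧ ⟶ W),
        ∑ p ∈ F, g p ≫ u p = ∑ b ∈ F.preimage e he.injOn, c b • u (e b) := by
      intro W u
      rw [← Finset.sum_preimage e F he.injOn (fun p => g p ≫ u p)
        (fun p _ hp => by rw [hg p hp, zero_comp])]
      refine Finset.sum_congr rfl fun b _ => ?_
      rw [hc b, Linear.smul_comp]
      exact congrArg _ (Category.id_comp _)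
    have hz : ∑ b ∈ F.preimage e he.injOn, c b • (b : (X j)⟦(-1 : ℤ)⟧ ⟶ R.Xs i n) = 0 := by
      rw [Preadditive.sum_comp] at hh
      simp only [Category.assoc] at hh
      rw [hsum (fun p => R.inc i n p ≫ R.α i n)] at hh
      simp only [R.inc_α] at hh
      exact hh
    have hc0 := linearIndependent_iff'.1 (R.B_indep j (-1) i n (by lia)) _ _ hz
    rw [hsum]
    exact Finset.sum_eq_zero fun b hb => by rw [hc0 b hb, zero_smul]

lemma exists_lift_β
    (hX : IsSimpleMindedCollection K Λ r X) {i j : Fin r} {n : ℕ} {m : ℤ} (hm : 0 ≤ m)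
    (f : (X j)⟦m⟧ ⟶ R.Xs i (n + 1)) : ∃ g : (X j)⟦m⟧ ⟶ R.Xs i n, f = g ≫ R.β i n :=
  exists_lift_of_comp_eq_zero (R.dist i n) (X j) m
    (fun h hh => R.hom_Z_eq_zero hX (by lia) h hh) f

lemma hom_Xs_eq_zero
    (hX : IsSimpleMindedCollection K Λ r X) {i j : Fin r} {n : ℕ} {m : ℤ} (hm : 0 < m)
    (f : (X j)⟦m⟧ ⟶ R.Xs i n) :
    f = 0 := by
  induction n with
  | zero =>
    let e : R.Xs i 0 ≅ (X i)⟦(0 : ℤ)⟧ := eqToIso (R.Xs_zero i) ≪≫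
    ((shiftFunctorZero _ ℤ).app _).symm
    rw [← cancel_mono e.hom, hX.hom_shift_eq_zero hm (f ≫ e.hom), zero_comp]
  | succ n ih =>
    obtain ⟨g, rfl⟩ := R.exists_lift_β hX hm.le f
    rw [ih g, zero_comp]

lemma hom_T_eq_zero_of_pos
    (hX : IsSimpleMindedCollection K Λ r X) {i j : Fin r} {m : ℤ} (hm : 0 < m)
    (f : (X j)⟦m⟧ ⟶ R.T i) :
    f = 0 := by
  obtain ⟨F, g, rfl⟩ := R.exists_eq_sum_toT hX f
  refine Finset.sum_eq_zero fun n _ => ?_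
  rw [R.hom_Xs_eq_zero hX hm (g n), zero_comp]

lemma exists_comp_cinc_toT
    (hX : IsSimpleMindedCollection K Λ r X) {i j : Fin r} {n : ℕ} (g : (X j)⟦(0 : ℤ)⟧ ⟶ R.Xs i n) :
    ∃ g' : (X j)⟦(0 : ℤ)⟧ ⟶ R.Xs i 0,
      g ≫ R.cinc i n ≫ R.toT i = g' ≫ R.cinc i 0 ≫ R.toT i := by
  induction n with
  | zero => exact ⟨g, rfl⟩
  | succ n ih =>
    obtain ⟨k, rfl⟩ := R.exists_lift_β hX le_rfl g
    obtain ⟨g', hg'⟩ := ih k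
    exact ⟨g', by rw [← hg', Category.assoc, ← R.cinc_toT]⟩

lemma finite_hom_T
    (hX : IsSimpleMindedCollection K Λ r X) (i j : Fin r) (m : ℤ) : Module.Finite K
    ((X j)⟦m⟧ ⟶ R.T i) := by
  obtain hm | rfl | hm := lt_trichotomy m 0
  · have := subsingleton_of_forall_eq 0 fun f => R.hom_T_eq_zero_of_neg hX (i := i) (j := j) hm f
    infer_instance
  · have := R.finite_hom_Xs_zero hX i j
    refine Module.Finite.of_surjective
      (Linear.rightComp K ((X j)⟦(0 : ℤ)⟧) (R.cinc i 0 ≫ R.toT i)) fun f => ?_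
    obtain ⟨F, g, rfl⟩ := R.exists_eq_sum_toT hX f
    choose g' hg' using fun n => R.exists_comp_cinc_toT hX (g n)
    refine ⟨∑ n ∈ F, g' n, ?_⟩
    rw [map_sum]
    exact Finset.sum_congr rfl fun n _ => (hg' n).symm
  · have := subsingleton_of_forall_eq 0 fun f => R.hom_T_eq_zero_of_pos hX (i := i) (j := j) hm f
    infer_instance

end RickardData

section Thick

variable {K : Type*} [Field K] {D : Type*} [Category D] [Preadditive D] [HasZeroObject D]
  [HasShift D ℤ] [∀ n : ℤ, (shiftFunctor D n).Additive] [Pretriangulated D] [Linear K D]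

lemma finite_hom_of_distTriang {T : Triangle D} (hT : T ∈ distTriang D) (Y : D)
    [Module.Finite K (T.obj₁ ⟶ Y)] [Module.Finite K (T.obj₃ ⟶ Y)] :
    Module.Finite K (T.obj₂ ⟶ Y) := by
  have : Module.Finite K (LinearMap.ker (Linear.leftComp K Y T.mor₁)) := by
    have h : LinearMap.ker (Linear.leftComp K Y T.mor₁) ≤
        LinearMap.range (Linear.leftComp K Y T.mor₂) := fun f hf => by
      obtain ⟨g, rfl⟩ := Triangle.yoneda_exact₂ _ hT f hf
      exact ⟨g, rfl⟩
    exact Module.Finite.of_injective (Submodule.inclusion h) (Submodule.inclusion_injective h)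
  have : Module.Finite K ((T.obj₂ ⟶ Y) ⧸ LinearMap.ker (Linear.leftComp K Y T.mor₁)) :=
    Module.Finite.equiv (Linear.leftComp K Y T.mor₁).quotKerEquivRange.symm
  exact .of_submodule_quotient (LinearMap.ker (Linear.leftComp K Y T.mor₁))

lemma ThickMem.finite_hom {S : Set D} {Y : D}
    (hS : ∀ X ∈ S, ∀ m : ℤ, Module.Finite K (X⟦m⟧ ⟶ Y)) {C : D} (hC : ThickMem S C) (m : ℤ) :
    Module.Finite K (C⟦m⟧ ⟶ Y) := by
  induction hC generalizing m with
  | of X hX => exact hS X hX m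
  | zero =>
    have : Subsingleton ((0 : D)⟦m⟧ ⟶ Y) := subsingleton_of_forall_eq 0 fun f =>
      ((shiftFunctor D m).map_isZero (isZero_zero D)).eq_of_src _ _
    infer_instance
  | iso e _ ih =>
    have := ih m
    exact Module.Finite.equiv (Linear.homCongr K ((shiftFunctor D m).mapIso e) (Iso.refl Y))
  | shift X n _ ih =>
    have := ih (n + m)
    exact Module.Finite.equiv (Linear.homCongr K ((shiftFunctorAdd D n m).app X) (Iso.refl Y))
  | ext T hT _ _ h₁ h₃ =>
    exact @finite_hom_of_distTriang K _ D _ _ _ _ _ _ _ _ (Triangle.shift_distinguished T hT m) Y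
      (h₁ m) (h₃ m)
  | summand i p hip _ ih =>
    have := ih m
    refine Module.Finite.of_surjective (Linear.leftComp K Y (i⟦m⟧')) fun f => ⟨p⟦m⟧' ≫ f, ?_⟩
    change i⟦m⟧' ≫ p⟦m⟧' ≫ f = f
    rw [← Category.assoc, ← Functor.map_comp, hip, CategoryTheory.Functor.map_id, Category.id_comp]

lemma ThickMem.exists_hom_eq_zero {S : Set D} {Y : D}
    (hS : ∀ X ∈ S, ∃ N : ℤ, ∀ m < N, ∀ f : X⟦m⟧ ⟶ Y, f = 0) {C : D} (hC : ThickMem S C) :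
    ∃ N : ℤ, ∀ m < N, ∀ f : C⟦m⟧ ⟶ Y, f = 0 := by
  induction hC with
  | of X hX => exact hS X hX
  | zero =>
    exact ⟨0, fun m _ f => ((shiftFunctor D m).map_isZero (isZero_zero D)).eq_of_src _ _⟩
  | iso e _ ih =>
    obtain ⟨N, hN⟩ := ih
    refine ⟨N, fun m hm f => ?_⟩
    rw [← cancel_epi ((shiftFunctor D m).mapIso e).hom, hN m hm (_ ≫ f), comp_zero]
  | shift X n _ ih =>
    obtain ⟨N, hN⟩ := ih
    refine ⟨N - n, fun m hm f => ?_⟩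
    rw [← cancel_epi ((shiftFunctorAdd D n m).app X).hom, hN (n + m) (by lia) (_ ≫ f), comp_zero]
  | ext T hT _ _ h₁ h₃ =>
    obtain ⟨N₁, h₁⟩ := h₁
    obtain ⟨N₃, h₃⟩ := h₃
    refine ⟨min N₁ N₃, fun m hm f => ?_⟩
    obtain ⟨g, hg⟩ := Triangle.yoneda_exact₂ _ (Triangle.shift_distinguished T hT m) f
      (h₁ m (by lia) _)
    rw [hg]
    exact (congrArg _ (h₃ m (by lia) g)).trans comp_zero
  | summand i p hip _ ih =>
    obtain ⟨N, hN⟩ := ih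
    refine ⟨N, fun m hm f => ?_⟩
    rw [← Category.id_comp f, ← CategoryTheory.Functor.map_id, ← hip, Functor.map_comp,
      Category.assoc, hN m hm (_ ≫ f), comp_zero]

end Thick

/-- The short exact sequence attached to a submodule. -/
lemma shortExact_submodule {Λ : Type} [Ring Λ] {M : Type} [AddCommGroup M] [Module Λ M]
    (N : Submodule Λ M) :
    (ShortComplex.mk (ModuleCat.ofHom N.subtype) (ModuleCat.ofHom N.mkQ)
      (by ext x; simp)).ShortExact where
  exact := by
    rw [ShortComplex.moduleCat_exact_iff_range_eq_ker]
    simp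
  mono_f := (ModuleCat.mono_iff_injective _).2 N.injective_subtype
  epi_g := (ModuleCat.epi_iff_surjective _).2 N.mkQ_surjective

section

variable {Λ : Type} [Ring Λ] [HasDerivedCategory (ModuleCat.{0} Λ)]

lemma isDbObject_single (M : ModuleCat.{0} Λ) [Module.Finite Λ M] (n : ℤ) :
    IsDbObject Λ ((singleFunctor _ n).obj M) := by
  refine ⟨(HomologicalComplex.single _ (.up ℤ) n).obj M, ⟨n, n, fun i hi => ?_⟩, fun i => ?_,
    ⟨Iso.refl _⟩⟩
  · exact HomologicalComplex.isZero_single_obj_X (.up ℤ) n M i (by lia)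
  · by_cases hi : i = n
    · exact Module.Finite.equiv
        (HomologicalComplex.singleObjXIsoOfEq (.up ℤ) n M i hi).symm.toLinearEquiv
    · exact finite_of_isZero (HomologicalComplex.isZero_single_obj_X (.up ℤ) n M i hi)

lemma exists_single_distTriang {S : ShortComplex (ModuleCat.{0} Λ)} (hS : S.ShortExact) (n : ℤ) :
    ∃ δ : (singleFunctor _ n).obj S.X₃ ⟶ ((singleFunctor _ n).obj S.X₁)⟦(1 : ℤ)⟧,
      Triangle.mk ((singleFunctor _ n).map S.f) ((singleFunctor _ n).map S.g) δ ∈ distTriang _ :=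
  ⟨_, triangleOfSES_distinguished (hS.map_of_exact (HomologicalComplex.single _ (.up ℤ) n))⟩

/-- If no nonzero morphism exists from the shifted simple modules to `T`, the same holds for
modules of finite length. -/
lemma hom_single_eq_zero_of_simple {T : DerivedCategory (ModuleCat.{0} Λ)} {n : ℤ}
    (h : ∀ M : ModuleCat.{0} Λ, IsSimpleModule Λ M →
      ∀ f : (singleFunctor _ n).obj M ⟶ T, f = 0)
    (M : Type) [AddCommGroup M] [Module Λ M] (hM : IsFiniteLength Λ M)
    (f : (singleFunctor _ n).obj (ModuleCat.of Λ M) ⟶ T) : f = 0 := by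
  induction hM with
  | of_subsingleton =>
    exact ((singleFunctor _ n).map_isZero (ModuleCat.isZero_of_subsingleton _)).eq_of_src _ _
  | @of_simple_quotient M _ _ N hN _ ih =>
    obtain ⟨δ, hδ⟩ := exists_single_distTriang (shortExact_submodule N) n
    obtain ⟨g, hg⟩ := Triangle.yoneda_exact₂ _ hδ f (ih _)
    rw [hg]
    exact (congrArg _ (h (ModuleCat.of Λ (M ⧸ N)) hN g)).trans comp_zero

end

section

variable {K : Type} [Field K] {Λ : Type} [Ring Λ] [Algebra K Λ]
  [HasDerivedCategory (ModuleCat.{0} Λ)]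
  [CategoryTheory.Linear K (DerivedCategory (ModuleCat.{0} Λ))]
  [(Qh (C := ModuleCat.{0} Λ)).Linear K]

lemma singleEval_smul {n : ℤ} {P : ModuleCat.{0} Λ} {T : DerivedCategory (ModuleCat.{0} Λ)}
    (c : K) (f : (singleFunctor _ n).obj P ⟶ T) (x : P) :
    (singleEval (c • f)).hom x = algebraMap K Λ c • (singleEval f).hom x := by
  have := singleFunctor_linear K Λ n
  have h : c • f = (singleFunctor _ n).map (c • 𝟙 P) ≫ f := by
    rw [Functor.map_smul, CategoryTheory.Functor.map_id, Linear.smul_comp, Category.id_comp]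
  rw [h, singleEval_map_comp]
  exact (singleEval f).hom.map_smul (algebraMap K Λ c) x

lemma singleEval_add {n : ℤ} {P : ModuleCat.{0} Λ} {T : DerivedCategory (ModuleCat.{0} Λ)}
    (f g : (singleFunctor _ n).obj P ⟶ T) :
    singleEval (f + g) = singleEval f + singleEval g := by
  simp [singleEval]

lemma hasFiniteHomology_of_finite_hom {T : DerivedCategory (ModuleCat.{0} Λ)}
    (h : ∀ n, Module.Finite K ((singleFunctor _ n).obj (ModuleCat.of Λ Λ) ⟶ T)) :
    HasFiniteHomology T := by
  intro n
  obtain ⟨s, hs⟩ := (h n).fg_top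
  classical
  let u (f : (singleFunctor _ n).obj (ModuleCat.of Λ Λ) ⟶ T) :
      (homologyFunctor (ModuleCat.{0} Λ) n).obj T := (singleEval f).hom (1 : Λ)
  refine ⟨⟨s.image u, top_unique fun x _ => ?_⟩⟩
  obtain ⟨f, hf⟩ := singleEval_surjective (n := n) (X := T)
    (ModuleCat.ofHom (LinearMap.toSpanSingleton Λ _ x))
  have hx : u f = x := by
    simp only [u, hf]
    exact one_smul Λ x
  rw [← hx]
  clear hx hf
  have hf : f ∈ Submodule.span K (s : Set _) := by rw [hs]; trivial
  induction hf using Submodule.span_induction with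
  | mem f hf => exact Submodule.subset_span (Finset.mem_coe.2 (Finset.mem_image_of_mem u hf))
  | zero => simp [u, singleEval_zero]
  | add f g _ _ hf hg =>
    have h : u (f + g) = u f + u g := by simp [u, singleEval_add]
    rw [h]
    exact add_mem hf hg
  | smul c f _ hf =>
    have h : u (c • f) = algebraMap K Λ c • u f := singleEval_smul c f (1 : Λ)
    rw [h]
    exact Submodule.smul_mem _ _ hf

end

namespace RickardData

variable {K : Type} [Field K] {Λ : Type} [Ring Λ]
  [HasDerivedCategory (ModuleCat.{0} Λ)]
  [CategoryTheory.Linear K (DerivedCategory (ModuleCat.{0} Λ))]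
  {r : ℕ} {X : Fin r → DerivedCategory (ModuleCat.{0} Λ)} (R : RickardData K r X)
  [IsNoetherianRing Λ]

lemma exists_hom_single_eq_zero
    (hX : IsSimpleMindedCollection K Λ r X) (i : Fin r) (M : ModuleCat.{0} Λ) [Module.Finite Λ M] :
    ∃ N : ℤ, ∀ n > N, ∀ f : (singleFunctor _ n).obj M ⟶ R.T i, f = 0 := by
  obtain ⟨N, hN⟩ := ((hX.generates _).1 (isDbObject_single M 0)).exists_hom_eq_zero
    (Y := R.T i) (by
      rintro _ ⟨j, rfl⟩
      exact ⟨0, fun m hm f => R.hom_T_eq_zero_of_neg hX hm f⟩)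
  refine ⟨-N, fun n hn f => ?_⟩
  let e : ((singleFunctor _ 0).obj M)⟦-n⟧ ≅ (singleFunctor _ n).obj M :=
    ((singleFunctors (ModuleCat.{0} Λ)).shiftIso (-n) n 0 (by lia)).app M
  rw [← cancel_epi e.hom, hN (-n) (by lia) (e.hom ≫ f), comp_zero]

lemma exists_hom_single_eq_zero_of_finite
    (hX : IsSimpleMindedCollection K Λ r X) [IsArtinianRing Λ] (hr : IsCompleteFamilyOfSimples Λ r)
    (i : Fin r) : ∃ N : ℤ, ∀ (M : ModuleCat.{0} Λ) [Module.Finite Λ M], ∀ n > N,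
      ∀ f : (singleFunctor _ n).obj M ⟶ R.T i, f = 0 := by
  obtain ⟨S, hS, -, hS'⟩ := hr
  have (j : Fin r) : Module.Finite Λ (S j) := by
    have := hS j
    infer_instance
  choose N hN using fun j => R.exists_hom_single_eq_zero hX i (S j)
  obtain ⟨b, hb⟩ := (Set.finite_range N).bddAbove
  refine ⟨b, fun M _ n hn f => hom_single_eq_zero_of_simple (fun M hM f => ?_) M
    (isFiniteLength_iff_isNoetherian_isArtinian.2 ⟨inferInstance, inferInstance⟩) f⟩
  obtain ⟨j, ⟨e⟩⟩ := hS' M hM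
  have : N j ≤ b := hb ⟨j, rfl⟩
  rw [← cancel_epi ((singleFunctor _ n).map e.inv), hN j n (by lia) (_ ≫ f), comp_zero]

variable [Algebra K Λ] [(Qh (C := ModuleCat.{0} Λ)).Linear K]

lemma hasFiniteHomology_T
    (hX : IsSimpleMindedCollection K Λ r X) (i : Fin r) : HasFiniteHomology (R.T i) := by
  refine hasFiniteHomology_of_finite_hom (K := K) fun n => ?_
  have : Module.Finite Λ (ModuleCat.of Λ Λ) := inferInstanceAs (Module.Finite Λ Λ)
  have h := ((hX.generates _).1 (isDbObject_single (ModuleCat.of Λ Λ) n)).finite_hom (K := K)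
    (Y := R.T i) (by rintro _ ⟨j, rfl⟩ m; exact R.finite_hom_T hX i j m) 0
  exact @Module.Finite.equiv _ _ _ _ _ _ _ _ h
    (Linear.homCongr K ((shiftFunctorZero _ ℤ).app _) (Iso.refl _))

end RickardData

lemma finite_coextendScalars (K : Type) [Field K] (Λ : Type) [Ring Λ] [Algebra K Λ]
    [FiniteDimensional K Λ] (M : ModuleCat.{0} K) [FiniteDimensional K M] :
    Module.Finite Λ ((ModuleCat.coextendScalars (algebraMap K Λ)).obj M) := by
  let V := ((ModuleCat.restrictScalars (algebraMap K Λ)).obj (ModuleCat.of Λ Λ)) →ₗ[K] M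
  have : Module.Finite K ((ModuleCat.restrictScalars (algebraMap K Λ)).obj (ModuleCat.of Λ Λ)) :=
    Module.Finite.equiv (M := Λ)
      { AddEquiv.refl Λ with map_smul' := fun c x => Algebra.smul_def c x }
  have : Module.Finite K V := inferInstanceAs (Module.Finite K (_ →ₗ[K] M))
  obtain ⟨s, hs⟩ := this.fg_top
  let u : V → (ModuleCat.coextendScalars (algebraMap K Λ)).obj M := id
  classical
  refine ⟨⟨s.image u, top_unique fun (φ : V) _ => ?_⟩⟩
  change u φ ∈ _
  rename_i hφ
  clear hφ
  have hφ : φ ∈ Submodule.span K (s : Set V) := by rw [hs]; trivial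
  induction hφ using Submodule.span_induction with
  | mem f hf => exact Submodule.subset_span (Finset.mem_coe.2 (Finset.mem_image_of_mem u hf))
  | zero => exact zero_mem _
  | add f g _ _ hf hg => exact add_mem hf hg
  | smul c f _ hf =>
    have h : u (c • f) = algebraMap K Λ c • u f := by
      refine LinearMap.ext fun x => ?_
      refine (f.map_smul c x).symm.trans (congrArg f ?_)
      exact Algebra.commutes (A := Λ) c x
    rw [h]
    exact Submodule.smul_mem _ _ hf

/-- A finitely generated module over a finite-dimensional algebra embeds in a finitely generated
injective module. -/
lemma exists_mono_finite_injective (K : Type) [Field K] {Λ : Type} [Ring Λ] [Algebra K Λ]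
    [FiniteDimensional K Λ] (M : ModuleCat.{0} Λ) [Module.Finite Λ M] :
    ∃ (I : ModuleCat.{0} Λ) (_ : Injective I) (_ : Module.Finite Λ I) (f : M ⟶ I), Mono f := by
  let adj := ModuleCat.restrictCoextendScalarsAdj (algebraMap K Λ)
  let N := (ModuleCat.restrictScalars (algebraMap K Λ)).obj M
  have : Module.Finite K N := by
    let : Module K M := Module.compHom M (algebraMap K Λ)
    have : IsScalarTower K Λ M := ⟨fun c x m => by rw [Algebra.smul_def, mul_smul]; rfl⟩
    have h : Module.Finite K M := Module.Finite.trans Λ M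
    exact h
  have := Module.injective_of_isSemisimpleRing K N
  have : Injective N := Module.injective_object_of_injective_module K N
  exact ⟨(ModuleCat.coextendScalars (algebraMap K Λ)).obj N,
    Injective.injective_of_adjoint adj N, finite_coextendScalars K Λ N,
    adj.unit.app M, adj.unit_mono_of_L_faithful M⟩

section

variable {C : Type*} [Category C] [Abelian C] [HasDerivedCategory C]

instance isKInjective_single (I : C) [Injective I] (n : ℤ) :
    CochainComplex.IsKInjective ((HomologicalComplex.single C (ComplexShape.up ℤ) n).obj I) := by
  have : ∀ i, Injective (((HomologicalComplex.single C (ComplexShape.up ℤ) n).obj I).X i) := by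
    intro i
    by_cases hi : i = n
    · exact Injective.of_iso (HomologicalComplex.singleObjXIsoOfEq _ n I i hi).symm inferInstance
    · exact Injective.of_iso
        (HomologicalComplex.isZero_single_obj_X (.up ℤ) n I i hi).isoZero.symm inferInstance
  exact CochainComplex.isKInjective_of_injective _ n

lemma hom_single_injective_eq_zero {M I : C} [Injective I] {m n : ℤ} (h : m ≠ n)
    (f : (singleFunctor C m).obj M ⟶ (singleFunctor C n).obj I) : f = 0 := by
  obtain ⟨φ, rfl⟩ := exists_Q_map_eq_of_isKInjective
    ((HomologicalComplex.single C (ComplexShape.up ℤ) m).obj M)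
    ((HomologicalComplex.single C (ComplexShape.up ℤ) n).obj I) f
  have : φ = 0 := by
    refine HomologicalComplex.hom_ext _ _ fun i => ?_
    by_cases hi : i = m
    · exact (HomologicalComplex.isZero_single_obj_X (.up ℤ) n I i (by lia)).eq_of_tgt _ _
    · exact (HomologicalComplex.isZero_single_obj_X (.up ℤ) m M i hi).eq_of_src _ _
  exact (congrArg Q.map this).trans (Functor.map_zero _ _ _)

lemma hom_shift_single_injective_eq_zero {M I : C} [Injective I] {m n a : ℤ} (h : m + a ≠ n)
    (f : (singleFunctor C m).obj M ⟶ ((singleFunctor C n).obj I)⟦a⟧) : f = 0 := by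
  let e : ((singleFunctor C n).obj I)⟦a⟧ ≅ (singleFunctor C (n - a)).obj I :=
    ((singleFunctors C).shiftIso a (n - a) n (by lia)).app I
  rw [← cancel_mono e.hom, hom_single_injective_eq_zero (by lia) (f ≫ e.hom), zero_comp]

/-- A monomorphism from the lowest homology object of `T` to an injective object `I` extends to
a morphism `T ⟶ I[-n]` in the derived category. -/
lemma exists_hom_single_injective (T : DerivedCategory C) (n : ℤ) {I : C} [Injective I]
    (i : (homologyFunctor C n).obj T ⟶ I) [Mono i] :
    ∃ f : T ⟶ (singleFunctor C n).obj I, Mono ((homologyFunctor C n).map f) := by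
  obtain ⟨L, ⟨e⟩⟩ : ∃ L, Nonempty (Q.obj L ≅ T) := ⟨_, ⟨Q.objObjPreimageIso T⟩⟩
  let j : L.homology n ⟶ I := (homologyQIso L n).hom ≫ (homologyFunctor C n).map e.hom ≫ i
  let k := Injective.factorThru j (HomologicalComplex.homologyι L n)
  have hk : HomologicalComplex.homologyι L n ≫ k = j := Injective.comp_factorThru _ _
  let φ : L ⟶ (HomologicalComplex.single C (.up ℤ) n).obj I :=
    HomologicalComplex.mkHomToSingle (HomologicalComplex.pOpcycles L n ≫ k) (by simp)
  have hφ : HomologicalComplex.homologyMap φ n ≫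
      (HomologicalComplex.singleObjHomologySelfIso (.up ℤ) n I).hom = j := by
    rw [← cancel_epi (HomologicalComplex.homologyπ L n)]
    simp [φ, ← hk, HomologicalComplex.singleObjCyclesSelfIso_hom]
  have : Mono (HomologicalComplex.homologyMap φ n) := by
    have : Mono j := inferInstance
    rw [← hφ] at this
    exact mono_of_mono _ (HomologicalComplex.singleObjHomologySelfIso (.up ℤ) n I).hom
  refine ⟨e.inv ≫ Q.map φ, ?_⟩
  have h := homologyQIso_hom_naturality φ n
  rw [← Iso.eq_inv_comp] at h
  have h' : (homologyFunctor C n).map (e.inv ≫ Q.map φ) =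
      (homologyFunctor C n).map e.inv ≫ (homologyQIso L n).inv ≫
        HomologicalComplex.homologyMap φ n ≫ (homologyQIso _ n).hom :=
    (Functor.map_comp _ _ _).trans (congrArg _ h)
  have : Mono ((homologyFunctor C n).map e.inv ≫ (homologyQIso L n).inv ≫
        HomologicalComplex.homologyMap φ n ≫
          (homologyQIso ((HomologicalComplex.single C (.up ℤ) n).obj I) n).hom) := inferInstance
  rw [← h'] at this
  exact this

end

section

variable {Λ : Type} [Ring Λ] [HasDerivedCategory (ModuleCat.{0} Λ)]

/-- `T` is isomorphic to a bounded complex of finitely generated injective modules. -/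
def IsBoundedInjective (T : DerivedCategory (ModuleCat.{0} Λ)) : Prop :=
  ∃ I : CochainComplex (ModuleCat.{0} Λ) ℤ,
    (∃ a b : ℤ, ∀ n : ℤ, (n < a ∨ b < n) → IsZero (I.X n)) ∧
    (∀ n : ℤ, Injective (I.X n)) ∧
    (∀ n : ℤ, Module.Finite Λ (I.X n)) ∧
    Nonempty (Q.obj I ≅ T)

lemma IsBoundedInjective.of_iso {T T' : DerivedCategory (ModuleCat.{0} Λ)}
    (h : IsBoundedInjective T) (e : T ≅ T') : IsBoundedInjective T' :=
  let ⟨I, hb, hi, hf, ⟨e'⟩⟩ := h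
  ⟨I, hb, hi, hf, ⟨e' ≪≫ e⟩⟩

lemma isBoundedInjective_single (J : ModuleCat.{0} Λ) [Injective J] [Module.Finite Λ J] (n : ℤ) :
    IsBoundedInjective ((singleFunctor _ n).obj J) := by
  refine ⟨(HomologicalComplex.single _ (.up ℤ) n).obj J, ⟨n, n, fun i hi => ?_⟩, fun i => ?_,
    fun i => ?_, ⟨Iso.refl _⟩⟩
  · exact HomologicalComplex.isZero_single_obj_X (.up ℤ) n J i (by lia)
  · by_cases hi : i = n
    · exact Injective.of_iso
        (HomologicalComplex.singleObjXIsoOfEq (.up ℤ) n J i hi).symm inferInstance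
    · exact Injective.of_iso
        (HomologicalComplex.isZero_single_obj_X (.up ℤ) n J i hi).isoZero.symm inferInstance
  · by_cases hi : i = n
    · exact Module.Finite.equiv
        (HomologicalComplex.singleObjXIsoOfEq (.up ℤ) n J i hi).symm.toLinearEquiv
    · exact finite_of_isZero (HomologicalComplex.isZero_single_obj_X (.up ℤ) n J i hi)

lemma IsBoundedInjective.obj₃ {T : Triangle (DerivedCategory (ModuleCat.{0} Λ))}
    (hT : T ∈ distTriang _) (h₁ : IsBoundedInjective T.obj₁) (h₂ : IsBoundedInjective T.obj₂) :
    IsBoundedInjective T.obj₃ := by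
  obtain ⟨I, ⟨a, b, hI⟩, hI', hI'', ⟨e₁⟩⟩ := h₁
  obtain ⟨J, ⟨a', b', hJ⟩, hJ', hJ'', ⟨e₂⟩⟩ := h₂
  have : J.IsStrictlyGE a' := by
    rw [CochainComplex.isStrictlyGE_iff]
    exact fun i hi => hJ i (.inl hi)
  have := CochainComplex.isKInjective_of_injective J a'
  obtain ⟨φ, hφ⟩ := exists_Q_map_eq_of_isKInjective I J (e₁.hom ≫ T.mor₁ ≫ e₂.inv)
  let e (i : ℤ) : (CochainComplex.mappingCone φ).X i ≅ I.X (i + 1) ⊞ J.X i :=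
    HomologicalComplex.homotopyCofiber.XIsoBiprod φ i (i + 1) rfl
  refine ⟨CochainComplex.mappingCone φ, ⟨min (a - 1) a', max b b', fun i hi => ?_⟩, fun i => ?_,
    fun i => ?_, ⟨Triangle.π₃.mapIso (isoTriangleOfIso₁₂ _ _
      (mappingCone_triangle_distinguished φ) hT e₁ e₂ ?_)⟩⟩
  · exact ((biprod_isZero_iff _ _).2 ⟨hI _ (by lia), hJ _ (by lia)⟩).of_iso (e i)
  · exact Injective.of_iso (e i).symm inferInstance
  · have := hI'' (i + 1)
    have := hJ'' i
    exact Module.Finite.equiv (e i ≪≫ ModuleCat.biprodIsoProd _ _).symm.toLinearEquiv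
  · change Q.map φ ≫ e₂.hom = e₁.hom ≫ T.mor₁
    simp [hφ]

/-- An object of the heart shifted to degree `n` is injective if it receives no nonzero morphisms
from finitely generated modules placed in degree `n + 1`. -/
lemma injective_of_hom_single_eq_zero (J : ModuleCat.{0} Λ) (n : ℤ)
    (h : ∀ (M : ModuleCat.{0} Λ) [Module.Finite Λ M],
      ∀ f : (singleFunctor _ (n + 1)).obj M ⟶ (singleFunctor _ n).obj J, f = 0) : Injective J := by
  suffices Module.Injective Λ J from Module.injective_object_of_injective_module Λ J
  refine Module.Baer.injective fun I g => ?_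
  obtain ⟨δ, hδ⟩ := exists_single_distTriang (shortExact_submodule (M := Λ) I) n
  let e : ((singleFunctor _ n).obj (ModuleCat.of Λ (Λ ⧸ I)))⟦(-1 : ℤ)⟧ ≅
      (singleFunctor _ (n + 1)).obj (ModuleCat.of Λ (Λ ⧸ I)) :=
    ((singleFunctors (ModuleCat.{0} Λ)).shiftIso (-1) (n + 1) n (by lia)).app _
  have : Module.Finite Λ (ModuleCat.of Λ (Λ ⧸ I)) := inferInstanceAs (Module.Finite Λ (Λ ⧸ I))
  have hz (u : ((singleFunctor _ n).obj (ModuleCat.of Λ (Λ ⧸ I)))⟦(-1 : ℤ)⟧ ⟶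
      (singleFunctor _ n).obj J) : u = 0 := by
    rw [← cancel_epi e.inv, h _ (e.inv ≫ u), comp_zero]
  obtain ⟨k, hk⟩ := exists_extension_of_invRotate hδ ((singleFunctor _ n).map (ModuleCat.ofHom g))
    (hz _)
  obtain ⟨l, rfl⟩ := (singleFunctor _ n).map_surjective k
  have hk' : (singleFunctor _ n).map (ModuleCat.ofHom g) =
      (singleFunctor _ n).map (ModuleCat.ofHom I.subtype) ≫ (singleFunctor _ n).map l := hk
  have hl : ModuleCat.ofHom g = ModuleCat.ofHom I.subtype ≫ l :=
    (singleFunctor _ n).map_injective (hk'.trans (Functor.map_comp _ _ _).symm)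
  exact ⟨l.hom, fun x hx => (congrArg (fun φ => φ.hom ⟨x, hx⟩) hl).symm⟩

end

lemma isBoundedInjective_of_hom_single_eq_zero (K : Type) [Field K] {Λ : Type} [Ring Λ]
    [Algebra K Λ] [FiniteDimensional K Λ] [HasDerivedCategory (ModuleCat.{0} Λ)]
    (d : ℕ) (n N : ℤ) (hN : N = n + d) (T : DerivedCategory (ModuleCat.{0} Λ)) (hT : T.IsGE n)
    (hfin : HasFiniteHomology T)
    (h : ∀ (M : ModuleCat.{0} Λ) [Module.Finite Λ M], ∀ m > N,
      ∀ f : (singleFunctor _ m).obj M ⟶ T, f = 0) : IsBoundedInjective T := by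
  have : IsNoetherianRing Λ := IsNoetherianRing.of_finite K Λ
  induction d generalizing n T with
  | zero =>
    obtain rfl : N = n := by simpa using hN
    have : Module.Finite Λ (ModuleCat.of Λ Λ) := inferInstanceAs (Module.Finite Λ Λ)
    have := isLE_of_hom_single_eq_zero T N (h _)
    obtain ⟨J, ⟨e⟩⟩ := exists_iso_singleFunctor_obj_of_isGE_of_isLE T N
    have := injective_of_hom_single_eq_zero J N fun M _ f => by
      rw [← cancel_mono e.inv, h M (N + 1) (by lia) (f ≫ e.inv), zero_comp]
    have := hfin.of_iso e N
    have : Module.Finite Λ J := Module.Finite.equiv (singleHomologyIso N J).symm.toLinearEquiv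
    exact (isBoundedInjective_single J N).of_iso e.symm
  | succ d ih =>
    have := hfin n
    obtain ⟨I, _, _, i, _⟩ := exists_mono_finite_injective K
      ((homologyFunctor (ModuleCat.{0} Λ) n).obj T)
    obtain ⟨f, hf⟩ := exists_hom_single_injective T n i
    obtain ⟨T', g, δ, hT'⟩ := distinguished_cocone_triangle₁ f
    let e : ((singleFunctor _ n).obj I)⟦(-1 : ℤ)⟧ ≅ (singleFunctor _ (n + 1)).obj I :=
      ((singleFunctors (ModuleCat.{0} Λ)).shiftIso (-1) (n + 1) n (by lia)).app _
    have hinv := inv_rot_of_distTriang _ hT'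
    refine IsBoundedInjective.obj₃ hinv ((isBoundedInjective_single I (n + 1)).of_iso e.symm)
      (ih (n + 1) (by push_cast at hN; lia) T' ?_
        (HasFiniteHomology.obj₁ hT' hfin (hasFiniteHomology_single I n)) fun M _ m hm k => ?_)
    · rw [isGE_iff]
      intro p hp
      have hz : IsZero ((homologyFunctor (ModuleCat.{0} Λ) (p - 1)).obj
          ((singleFunctor _ n).obj I)) :=
        isZero_of_isGE ((singleFunctor _ n).obj I) n (p - 1) (by lia)
      have hmono : Mono ((homologyFunctor (ModuleCat.{0} Λ) p).map f) := by
        obtain rfl | hp' := (show p = n ∨ p < n by lia)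
        · exact hf
        · exact ⟨fun u v _ => (isZero_of_isGE T n p hp').eq_of_tgt u v⟩
      refine (HomologySequence.exact₁ _ hT' (p - 1) p).isZero_X₂ (hz.eq_of_src _ _) ?_
      change (homologyFunctor (ModuleCat.{0} Λ) p).map g = 0
      have hgf : g ≫ f = 0 := comp_distTriang_mor_zero₁₂ _ hT'
      rw [← cancel_mono ((homologyFunctor (ModuleCat.{0} Λ) p).map f), ← Functor.map_comp, hgf,
        Functor.map_zero, zero_comp]
    · obtain ⟨l, hl⟩ := Triangle.coyoneda_exact₂ _ hinv k (h M m hm (k ≫ g))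
      rw [hl]
      have : l = 0 := hom_shift_single_injective_eq_zero (I := I) (n := n) (a := -1)
        (by push_cast at hN; lia) l
      rw [this]
      exact zero_comp

end RickardKoenigYang

namespace RickardKoenigYang

/-- **Lemma 5.5 of Rickard's construction** (Lemma `L:T` b)).
Each `T_i` is isomorphic in `D(Mod Λ)` to a bounded complex of finitely generated
injective `Λ`-modules. -/
theorem rickardT_iso_bounded_complex_of_injectives
    (K : Type) [Field K] [IsAlgClosed K]
    (Λ : Type) [Ring Λ] [Algebra K Λ] [FiniteDimensional K Λ]
    (hbasic : IsBasicAlgebra K Λ)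
    [HasDerivedCategory (ModuleCat.{0} Λ)]
    [CategoryTheory.Linear K (DerivedCategory (ModuleCat.{0} Λ))]
    [(DerivedCategory.Qh (C := ModuleCat.{0} Λ)).Linear K]
    (r : ℕ) (hr : IsCompleteFamilyOfSimples Λ r)
    (X : Fin r → DerivedCategory (ModuleCat.{0} Λ))
    (hX : IsSimpleMindedCollection K Λ r X)
    (R : RickardData K r X) :
    ∀ i : Fin r, ∃ I : CochainComplex (ModuleCat.{0} Λ) ℤ,
      (∃ a b : ℤ, ∀ n : ℤ, (n < a ∨ b < n) → IsZero (I.X n)) ∧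
      (∀ n : ℤ, Injective (I.X n)) ∧
      (∀ n : ℤ, Module.Finite Λ (I.X n)) ∧
      Nonempty (DerivedCategory.Q.obj I ≅ R.T i) := by
  intro i
  have : IsNoetherianRing Λ := IsNoetherianRing.of_finite K Λ
  have : IsArtinianRing Λ := IsArtinianRing.of_finite K Λ
  obtain ⟨a, ha⟩ := hX.exists_isGE
  obtain ⟨N, hN⟩ := R.exists_hom_single_eq_zero_of_finite hX hr i
  exact isBoundedInjective_of_hom_single_eq_zero K (N - (a - 1)).toNat (a - 1) (max N (a - 1))
    (by lia) (R.T i) (R.isGE_T hX ha i) (R.hasFiniteHomology_T hX i)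
    fun M _ m hm f => hN M m (by lia) f

end RickardKoenigYang
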